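/- arXiv:2210.14340 — 2 statements merged into one kernel-verified Lean document; each statement's English description precedes it below -/
import Mathlib

section
/- Let p ∈ (2,∞). Then for every f ∈ C²_p, lim_{h↓0} (I^Mart(h)f − μf)/h = φ*( (1/2) ( ∫_X (|∇²f(y)|_Max)^{p/(p−2)} μ(dy) )^{(p−2)/p} ), where μf := ∫_X f dμ and φ* is the convex conjugate of φ. -/
open MeasureTheory Filter Set
open scoped Topology ENNReal NNReal RealInnerProductSpace

noncomputable section

variable {X : Type*} [NormedAddCommGroup X] [InnerProductSpace ℝ X]
  [SecondCountableTopology X] [CompleteSpace X] [MeasurableSpace X] [BorelSpace X]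

/-- `π` is a coupling of `μ` and `ν`. -/
def IsCoupling (μ ν : Measure X) (π : Measure (X × X)) : Prop :=
  π.map Prod.fst = μ ∧ π.map Prod.snd = ν

/-- The `p`-Wasserstein distance between `μ` and `ν` (valued in `ℝ≥0∞`). -/
def Wp (p : ℝ) (μ ν : Measure X) : ℝ≥0∞ :=
  (⨅ π ∈ {π : Measure (X × X) | IsCoupling μ ν π},
    ∫⁻ q, (‖q.1 - q.2‖₊ : ℝ≥0∞) ^ p ∂π) ^ (1 / p)

/-- Borel probability measures with finite `p`-th moment. -/
def Pp (p : ℝ) : Set (Measure X) :=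
  {ν | IsProbabilityMeasure ν ∧ ∫⁻ x, (‖x‖₊ : ℝ≥0∞) ^ p ∂ν < ⊤}

/-- The rescaled penalty function `φ_h(v) = h·φ(v/h)`. -/
def phih (φ : ℝ → ℝ≥0∞) (h v : ℝ) : ℝ≥0∞ := ENNReal.ofReal h * φ (v / h)

/-- The risk functional `I(h) f`. -/
def Ifun (μ : Measure X) (φ : ℝ → ℝ≥0∞) (p h : ℝ) (f : X → ℝ) : EReal :=
  ⨆ ν ∈ Pp (X := X) p,
    ((∫ x, f x ∂ν : ℝ) : EReal) - ((phih φ h (Wp p μ ν).toReal : ℝ≥0∞) : EReal)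

/-- The `L_p(μ; X)` norm of a vector field. -/
def lpnorm (μ : Measure X) (p : ℝ) (θ : X → X) : ℝ := (∫ y, ‖θ y‖ ^ p ∂μ) ^ (1 / p)

/-- The parametric risk functional `I_Θ(h) f`, where `μ_θ` is the pushforward of `μ`
under `y ↦ y + θ(y)`. -/
def ITheta (μ : Measure X) (φ : ℝ → ℝ≥0∞) (p : ℝ) (Θ : Set (X → X)) (h : ℝ)
    (f : X → ℝ) : EReal :=
  ⨆ θ ∈ Θ, ((∫ x, f x ∂(μ.map fun y => y + θ y) : ℝ) : EReal)
    - ((phih φ h (lpnorm μ p θ) : ℝ≥0∞) : EReal)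

/-- Membership in `Lip_p`. -/
def MemLipP (p : ℝ) (f : X → ℝ) : Prop :=
  ∃ L : ℝ, 0 ≤ L ∧ ∀ x₁ x₂ : X,
    |f x₁ - f x₂| ≤ L * (1 + max ‖x₁‖ ‖x₂‖) ^ (p - 1) * ‖x₁ - x₂‖

/-- The local Lipschitz constant `|f|_Lip`. -/
def locLip (f : X → ℝ) (x : X) : ℝ :=
  limsup (fun h : ℝ =>
      sSup ((fun u : X => (f (x + h • u) - f x) / h) '' {u : X | ‖u‖ = 0 ∨ ‖u‖ = 1}))
    (𝓝[>] (0 : ℝ))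

/-- `v` is a measurable direction of steepest ascent for `f`. -/
def SteepestAscent (f : X → ℝ) (v : X → X) : Prop :=
  Measurable v ∧ ∀ x : X, (‖v x‖ = 0 ∨ ‖v x‖ = 1) ∧
    Tendsto (fun h : ℝ => (f (x + h • v x) - f x) / h) (𝓝[>] (0 : ℝ)) (𝓝 (locLip f x))

/-- The convex conjugate `φ*` of the penalty function. -/
def phiStar (φ : ℝ → ℝ≥0∞) (u : ℝ) : EReal :=
  ⨆ v ∈ Ici (0 : ℝ), ((u * v : ℝ) : EReal) - ((φ v : ℝ≥0∞) : EReal)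

/-- `π` is a martingale coupling of `μ` and `ν`. -/
def IsMartCoupling (μ ν : Measure X) (π : Measure (X × X)) : Prop :=
  IsCoupling μ ν π ∧ ∀ B : Set X, MeasurableSet B →
    ∫ q, Set.indicator B (fun _ => (1 : ℝ)) q.1 • q.2 ∂π
      = ∫ y, Set.indicator B (fun _ => (1 : ℝ)) y • y ∂μ

/-- Measures in `P_p` admitting a martingale coupling with `μ`. -/
def Mp (p : ℝ) (μ : Measure X) : Set (Measure X) :=
  {ν | ν ∈ Pp (X := X) p ∧ ∃ π : Measure (X × X), IsMartCoupling μ ν π}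

/-- The `p`-martingale Wasserstein distance. -/
def WpMart (p : ℝ) (μ ν : Measure X) : ℝ≥0∞ :=
  (⨅ π ∈ {π : Measure (X × X) | IsMartCoupling μ ν π},
    ∫⁻ q, (‖q.2 - q.1‖₊ : ℝ≥0∞) ^ p ∂π) ^ (1 / p)

/-- The martingale-constrained risk functional `I^Mart(h) f`. -/
def IMart (μ : Measure X) (φ : ℝ → ℝ≥0∞) (p h : ℝ) (f : X → ℝ) : EReal :=
  ⨆ ν ∈ Mp p μ, ((∫ x, f x ∂ν : ℝ) : EReal)
    - ((phih φ h ((WpMart p μ ν).toReal ^ 2) : ℝ≥0∞) : EReal)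

/-- The randomized perturbation `μ_θ^Mart`, satisfying
`∫ f dμ_θ^Mart = ∫ (f(y+θ(y)) + f(y-θ(y)))/2 μ(dy)`. -/
def muMart (μ : Measure X) (θ : X → X) : Measure X :=
  (2 : ℝ≥0∞)⁻¹ • μ.map (fun y => y + θ y) + (2 : ℝ≥0∞)⁻¹ • μ.map (fun y => y - θ y)

/-- The parametric martingale risk functional `I^Mart_Θ(h) f`. -/
def IMartTheta (μ : Measure X) (φ : ℝ → ℝ≥0∞) (p : ℝ) (Θ : Set (X → X)) (h : ℝ)
    (f : X → ℝ) : EReal :=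
  ⨆ θ ∈ Θ, ((∫ x, f x ∂(muMart μ θ) : ℝ) : EReal)
    - ((phih φ h (lpnorm μ p θ ^ 2) : ℝ≥0∞) : EReal)

/-- Membership in `C²_p`: twice continuously Fréchet differentiable with Hessian growing
at most like `C(1+‖x‖)^{p-2}`. -/
def MemC2p (p : ℝ) (f : X → ℝ) : Prop :=
  ContDiff ℝ 2 f ∧ ∃ C : ℝ, 0 ≤ C ∧
    ∀ x : X, ‖fderiv ℝ (fun y => gradient f y) x‖ ≤ C * (1 + ‖x‖) ^ (p - 2)

/-- `|∇²f(x)|_Max = sup_{‖w‖ ≤ 1} ⟪w, ∇²f(x) w⟫`. -/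
def hessMax (f : X → ℝ) (x : X) : ℝ :=
  sSup ((fun w : X => ⟪w, fderiv ℝ (fun y => gradient f y) x w⟫) '' {w : X | ‖w‖ ≤ 1})

set_option linter.unusedSectionVars false

/-- The Hessian of `f`, as the derivative of its gradient. -/
def hess (f : X → ℝ) (y : X) : X →L[ℝ] X := fderiv ℝ (fun y => gradient f y) y

/-- The remainder of the second order Taylor expansion of `f` at `y`. -/
def taylorRem (f : X → ℝ) (y u : X) : ℝ :=
  f (y + u) - f y - ⟪gradient f y, u⟫ - 2⁻¹ * ⟪u, hess f y u⟫

lemma contDiff_gradient {f : X → ℝ} (hf : ContDiff ℝ 2 f) :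
    ContDiff ℝ 1 (fun y => gradient f y) :=
  (InnerProductSpace.toDual ℝ X).symm.contDiff.comp (hf.fderiv_right (by norm_num))

lemma continuous_hess {f : X → ℝ} (hf : ContDiff ℝ 2 f) : Continuous (hess f) :=
  (contDiff_gradient hf).continuous_fderiv (by norm_num)

lemma continuous_gradient {f : X → ℝ} (hf : ContDiff ℝ 2 f) :
    Continuous (fun y => gradient f y) :=
  (contDiff_gradient hf).continuous

lemma exists_taylor_mean_value {f : X → ℝ} (hf : ContDiff ℝ 2 f) (y u : X) :
    ∃ s ∈ Ioo (0 : ℝ) 1,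
      f (y + u) - f y - ⟪gradient f y, u⟫ = 2⁻¹ * ⟪u, hess f (y + s • u) u⟫ := by
  have hline : ∀ t : ℝ, HasDerivAt (fun t : ℝ => y + t • u) u t := fun t => by
    simpa using ((hasDerivAt_id t).smul_const u).const_add y
  have h1 : ∀ t : ℝ, HasDerivAt (fun t : ℝ => f (y + t • u)) ⟪gradient f (y + t • u), u⟫ t := by
    intro t
    have := ((hf.differentiable (by norm_num) (y + t • u)).hasGradientAt).hasFDerivAt
    exact (this.comp_hasDerivAt t (hline t)).congr_deriv (by simp)
  have h2 : ∀ t : ℝ, HasDerivAt (fun t : ℝ => ⟪gradient f (y + t • u), u⟫)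
      ⟪u, hess f (y + t • u) u⟫ t := by
    intro t
    have := ((contDiff_gradient hf).differentiable (by norm_num) (y + t • u)).hasFDerivAt
    have h3 := (this.comp_hasDerivAt t (hline t)).inner ℝ (hasDerivAt_const t u)
    simpa [real_inner_comm, hess] using h3
  have hk : ∀ t : ℝ, HasDerivAt (fun t : ℝ => f (y + t • u) - t * ⟪gradient f y, u⟫)
      (⟪gradient f (y + t • u), u⟫ - ⟪gradient f y, u⟫) t := by
    intro t
    exact ((h1 t).sub ((hasDerivAt_id t).mul_const ⟪gradient f y, u⟫)).congr_deriv
      (by rw [one_mul])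
  obtain ⟨r, hr, hreq⟩ := exists_ratio_hasDerivAt_eq_ratio_slope _ _ (zero_lt_one (α := ℝ))
    (fun t _ => (hk t).continuousAt.continuousWithinAt) (fun t _ => hk t)
    (fun t : ℝ => t ^ 2) (fun t => 2 * t) (by fun_prop)
    (fun t _ => by simpa using hasDerivAt_pow 2 t)
  obtain ⟨s, hs, hseq⟩ := exists_ratio_hasDerivAt_eq_ratio_slope _ _ hr.1
    (fun t _ => (h2 t).continuousAt.continuousWithinAt) (fun t _ => h2 t)
    (fun t : ℝ => t) (fun _ => 1) (by fun_prop) (fun t _ => hasDerivAt_id t)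
  refine ⟨s, ⟨hs.1, hs.2.trans hr.2⟩, ?_⟩
  simp only [one_smul, zero_smul, add_zero] at hreq hseq
  have hr0 : r ≠ 0 := hr.1.ne'
  apply mul_left_cancel₀ hr0
  linarith

lemma continuous_taylorRem {f : X → ℝ} (hf : ContDiff ℝ 2 f) :
    Continuous (fun q : X × X => taylorRem f q.1 q.2) := by
  have h0 := hf.continuous
  have h1 := continuous_gradient hf
  have h2 := continuous_hess hf
  unfold taylorRem
  fun_prop

lemma exists_abs_taylorRem_le {f : X → ℝ} (hf : ContDiff ℝ 2 f) (y u : X) :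
    ∃ s ∈ Ioo (0 : ℝ) 1,
      |taylorRem f y u| ≤ 2⁻¹ * ‖hess f (y + s • u) - hess f y‖ * ‖u‖ ^ 2 := by
  obtain ⟨s, hs, h⟩ := exists_taylor_mean_value hf y u
  refine ⟨s, hs, ?_⟩
  have : taylorRem f y u = 2⁻¹ * ⟪u, (hess f (y + s • u) - hess f y) u⟫ := by
    rw [taylorRem, h, _root_.sub_apply, inner_sub_right]; ring
  rw [this, abs_mul, abs_of_pos (by norm_num : (0 : ℝ) < 2⁻¹), mul_assoc]
  gcongr
  calc |⟪u, (hess f (y + s • u) - hess f y) u⟫|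
      ≤ ‖u‖ * ‖(hess f (y + s • u) - hess f y) u‖ := abs_real_inner_le_norm _ _
    _ ≤ ‖u‖ * (‖hess f (y + s • u) - hess f y‖ * ‖u‖) := by
        gcongr; exact ContinuousLinearMap.le_opNorm _ _
    _ = _ := by ring

lemma add_rpow_le_two_rpow_mul {a b r : ℝ} (ha : 0 ≤ a) (hb : 0 ≤ b) (hr : 0 ≤ r) :
    (a + b) ^ r ≤ 2 ^ r * (a ^ r + b ^ r) := by
  have hm : (max a b) ^ r ≤ a ^ r + b ^ r := by
    rcases max_choice a b with h | h <;> rw [h]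
    · linarith [Real.rpow_nonneg hb r]
    · linarith [Real.rpow_nonneg ha r]
  calc (a + b) ^ r ≤ (2 * max a b) ^ r := by
        gcongr; linarith [le_max_left a b, le_max_right a b]
    _ = 2 ^ r * (max a b) ^ r := Real.mul_rpow (by norm_num) (le_max_of_le_left ha)
    _ ≤ _ := by gcongr

lemma rpow_mul_rpow_le_add {a b r s : ℝ} (ha : 0 ≤ a) (hb : 0 ≤ b) (hr : 0 ≤ r) (hs : 0 ≤ s)
    (hrs : 0 < r + s) : a ^ r * b ^ s ≤ a ^ (r + s) + b ^ (r + s) := by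
  rcases le_total a b with h | h
  · calc a ^ r * b ^ s ≤ b ^ r * b ^ s := by gcongr
      _ = b ^ (r + s) := (Real.rpow_add' hb hrs.ne').symm
      _ ≤ _ := by linarith [Real.rpow_nonneg ha (r + s)]
  · calc a ^ r * b ^ s ≤ a ^ r * a ^ s := by gcongr
      _ = a ^ (r + s) := (Real.rpow_add' ha hrs.ne').symm
      _ ≤ _ := by linarith [Real.rpow_nonneg hb (r + s)]

lemma rpow_sub_two_mul_sq {t p : ℝ} (ht : 0 ≤ t) (hp : 2 < p) : t ^ (p - 2) * t ^ 2 = t ^ p := by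
  rw [← Real.rpow_two, ← Real.rpow_add' ht (by linarith)]
  congr 1; ring

/-- The Hessian of `f` grows at most like `C (1 + ‖x‖) ^ (p - 2)`. -/
def HessGrowth (p C : ℝ) (f : X → ℝ) : Prop :=
  ContDiff ℝ 2 f ∧ 0 ≤ C ∧ ∀ x : X, ‖hess f x‖ ≤ C * (1 + ‖x‖) ^ (p - 2)

lemma HessGrowth.abs_taylorRem_le {p C : ℝ} (hp : 2 < p) {f : X → ℝ} (hf : HessGrowth p C f)
    (y u : X) :
    |taylorRem f y u| ≤ C * 2 ^ (p - 2) * ((1 + ‖y‖) ^ (p - 2) * ‖u‖ ^ 2 + ‖u‖ ^ p) := by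
  obtain ⟨hf2, hC, hH⟩ := hf
  obtain ⟨s, hs, h⟩ := exists_abs_taylorRem_le hf2 y u
  have hp2 : 0 ≤ p - 2 := by linarith
  have hsu : ‖y + s • u‖ ≤ ‖y‖ + ‖u‖ := by
    refine (norm_add_le _ _).trans ?_
    rw [norm_smul, Real.norm_of_nonneg hs.1.le]
    nlinarith [norm_nonneg u, hs.2]
  have h2 : (1 : ℝ) ≤ 2 ^ (p - 2) := Real.one_le_rpow (by norm_num) hp2
  have h3 : ‖hess f (y + s • u)‖ ≤ C * (2 ^ (p - 2) * ((1 + ‖y‖) ^ (p - 2) + ‖u‖ ^ (p - 2))) := by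
    refine (hH _).trans ?_
    gcongr
    calc (1 + ‖y + s • u‖) ^ (p - 2) ≤ ((1 + ‖y‖) + ‖u‖) ^ (p - 2) := by
          exact Real.rpow_le_rpow (by positivity) (by linarith) hp2
      _ ≤ _ := add_rpow_le_two_rpow_mul (by positivity) (by positivity) hp2
  have h4 : ‖hess f y‖ ≤ C * (2 ^ (p - 2) * ((1 + ‖y‖) ^ (p - 2) + ‖u‖ ^ (p - 2))) := by
    refine (hH _).trans ?_
    gcongr
    have := Real.rpow_nonneg (norm_nonneg u) (p - 2)
    have h5 : 0 ≤ (1 + ‖y‖) ^ (p - 2) := by positivity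
    nlinarith
  calc |taylorRem f y u| ≤ 2⁻¹ * ‖hess f (y + s • u) - hess f y‖ * ‖u‖ ^ 2 := h
    _ ≤ (C * (2 ^ (p - 2) * ((1 + ‖y‖) ^ (p - 2) + ‖u‖ ^ (p - 2)))) * ‖u‖ ^ 2 := by
        refine mul_le_mul_of_nonneg_right ?_ (by positivity)
        linarith [norm_sub_le (hess f (y + s • u)) (hess f y)]
    _ = C * 2 ^ (p - 2) * ((1 + ‖y‖) ^ (p - 2) * ‖u‖ ^ 2 + ‖u‖ ^ (p - 2) * ‖u‖ ^ 2) := by ring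
    _ = _ := by rw [rpow_sub_two_mul_sq (norm_nonneg u) hp]

lemma HessGrowth.norm_gradient_le {p C : ℝ} (hp : 2 < p) {f : X → ℝ} (hf : HessGrowth p C f)
    (y : X) : ‖gradient f y‖ ≤ (‖gradient f 0‖ + C) * (1 + ‖y‖) ^ (p - 1) := by
  obtain ⟨hf2, hC, hH⟩ := hf
  have hp2 : 0 ≤ p - 2 := by linarith
  have h := Convex.norm_image_sub_le_of_norm_fderiv_le (𝕜 := ℝ) (f := fun y => gradient f y)
    (s := Metric.closedBall (0 : X) ‖y‖) (C := C * (1 + ‖y‖) ^ (p - 2)) (x := 0) (y := y)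
    (fun x _ => (contDiff_gradient hf2).differentiable (by norm_num) x)
    (fun x hx => (hH x).trans (by
      have : ‖x‖ ≤ ‖y‖ := by simpa using hx
      gcongr))
    (convex_closedBall _ _) (by simp) (by simp)
  have h1 : (1 : ℝ) ≤ (1 + ‖y‖) ^ (p - 1) :=
    Real.one_le_rpow (by linarith [norm_nonneg y]) (by linarith)
  have h2 : (1 + ‖y‖) ^ (p - 2) * (1 + ‖y‖) = (1 + ‖y‖) ^ (p - 1) := by
    rw [← Real.rpow_add_one (by positivity)]; congr 1; ring
  have h3 : C * (1 + ‖y‖) ^ (p - 2) * ‖y - 0‖ ≤ C * (1 + ‖y‖) ^ (p - 1) := by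
    rw [← h2, ← mul_assoc, sub_zero]
    gcongr
    linarith
  have h4 : ‖gradient f y‖ ≤ ‖gradient f 0‖ + ‖gradient f y - gradient f 0‖ := by
    simpa using norm_add_le (gradient f 0) (gradient f y - gradient f 0)
  nlinarith [norm_nonneg (gradient f 0)]

lemma HessGrowth.abs_hess_le {p C : ℝ} {f : X → ℝ} (hf : HessGrowth p C f)
    (y u : X) : |⟪u, hess f y u⟫| ≤ C * (1 + ‖y‖) ^ (p - 2) * ‖u‖ ^ 2 := by
  calc |⟪u, hess f y u⟫| ≤ ‖u‖ * ‖hess f y u‖ := abs_real_inner_le_norm _ _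
    _ ≤ ‖u‖ * (‖hess f y‖ * ‖u‖) := by gcongr; exact ContinuousLinearMap.le_opNorm _ _
    _ = ‖hess f y‖ * ‖u‖ ^ 2 := by ring
    _ ≤ _ := by gcongr; exact hf.2.2 y

lemma HessGrowth.abs_le {p C : ℝ} (hp : 2 < p) {f : X → ℝ} (hf : HessGrowth p C f) :
    ∃ D, ∀ y, |f y| ≤ D * (1 + ‖y‖) ^ p := by
  refine ⟨|f 0| + ‖gradient f 0‖ + C + C * 2 ^ (p - 2) * 2, fun y => ?_⟩
  have hC := hf.2.1
  have h1 := hf.abs_taylorRem_le hp 0 y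
  have h2 := hf.abs_hess_le 0 y
  have h3 := abs_real_inner_le_norm (gradient f 0) y
  have e : f y = f 0 + ⟪gradient f 0, y⟫ + 2⁻¹ * ⟪y, hess f 0 y⟫ + taylorRem f 0 y := by
    simp [taylorRem]
  simp only [norm_zero, add_zero, Real.one_rpow, one_mul, mul_one] at h1 h2
  have k0 : (1 : ℝ) ≤ 1 + ‖y‖ := by linarith [norm_nonneg y]
  have g1 : (1 : ℝ) ≤ (1 + ‖y‖) ^ p := Real.one_le_rpow k0 (by linarith)
  have g2 : ‖y‖ ≤ (1 + ‖y‖) ^ p := by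
    have := Real.rpow_le_rpow_of_exponent_le k0 (by linarith : 1 ≤ p)
    rw [Real.rpow_one] at this; linarith
  have g3 : ‖y‖ ^ 2 ≤ (1 + ‖y‖) ^ p := by
    have := Real.rpow_le_rpow_of_exponent_le k0 hp.le
    rw [Real.rpow_two] at this
    nlinarith [norm_nonneg y]
  have g4 : ‖y‖ ^ p ≤ (1 + ‖y‖) ^ p := by gcongr; linarith
  have t : |f y| ≤ |f 0| + |⟪gradient f 0, y⟫| + 2⁻¹ * |⟪y, hess f 0 y⟫| + |taylorRem f 0 y| := by
    have := abs_add_le (f 0 + ⟪gradient f 0, y⟫ + 2⁻¹ * ⟪y, hess f 0 y⟫) (taylorRem f 0 y)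
    have := abs_add_le (f 0 + ⟪gradient f 0, y⟫) (2⁻¹ * ⟪y, hess f 0 y⟫)
    have := abs_add_le (f 0) ⟪gradient f 0, y⟫
    rw [abs_mul, abs_of_pos (by norm_num : (0 : ℝ) < 2⁻¹)] at *
    rw [← e] at *
    linarith
  have f1 : |f 0| ≤ |f 0| * (1 + ‖y‖) ^ p := le_mul_of_one_le_right (abs_nonneg _) g1
  have f2 : ‖gradient f 0‖ * ‖y‖ ≤ ‖gradient f 0‖ * (1 + ‖y‖) ^ p := by gcongr
  have f3 : C * ‖y‖ ^ 2 ≤ C * (1 + ‖y‖) ^ p := by gcongr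
  have f4 : C * 2 ^ (p - 2) * (‖y‖ ^ 2 + ‖y‖ ^ p) ≤
      C * 2 ^ (p - 2) * ((1 + ‖y‖) ^ p + (1 + ‖y‖) ^ p) := by gcongr
  nlinarith [abs_nonneg ⟪y, hess f 0 y⟫]

/-- The smallest function `k` such that `|taylorRem f y u| ≤ k y * ‖u‖ ^ 2 + K * ‖u‖ ^ p`
for all `u` in a fixed countable dense set. -/
def taylorMajorant (f : X → ℝ) (p K : ℝ) (y : X) : ℝ :=
  ⨆ n : ℕ, max 0 ((|taylorRem f y (TopologicalSpace.denseSeq X n)|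
    - K * ‖TopologicalSpace.denseSeq X n‖ ^ p) / ‖TopologicalSpace.denseSeq X n‖ ^ 2)

lemma measurable_taylorMajorant {f : X → ℝ} (hf : ContDiff ℝ 2 f) (p K : ℝ) :
    Measurable (taylorMajorant f p K) := by
  refine Measurable.iSup fun n => measurable_const.max (Measurable.div_const ?_ _)
  refine Measurable.sub_const ?_ _
  exact ((continuous_taylorRem hf).comp (Continuous.prodMk_left _)).abs.measurable

lemma taylorRem_zero_right (f : X → ℝ) (y : X) : taylorRem f y 0 = 0 := by simp [taylorRem]

lemma taylor_quotient_le {f : X → ℝ} {p K : ℝ} {y u : X} {c : ℝ} (hc : 0 ≤ c)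
    (h : |taylorRem f y u| ≤ c * ‖u‖ ^ 2 + K * ‖u‖ ^ p) :
    max 0 ((|taylorRem f y u| - K * ‖u‖ ^ p) / ‖u‖ ^ 2) ≤ c := by
  refine max_le hc ?_
  exact div_le_of_le_mul₀ (by positivity) hc (by linarith)

lemma taylorMajorant_le {f : X → ℝ} {p K : ℝ} {y : X} {c : ℝ} (hc : 0 ≤ c)
    (h : ∀ u, |taylorRem f y u| ≤ c * ‖u‖ ^ 2 + K * ‖u‖ ^ p) : taylorMajorant f p K y ≤ c :=
  ciSup_le fun _ => taylor_quotient_le hc (h _)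

lemma taylorMajorant_nonneg (f : X → ℝ) (p K : ℝ) (y : X) : 0 ≤ taylorMajorant f p K y :=
  Real.iSup_nonneg fun _ => le_max_left _ _

lemma abs_taylorRem_le_taylorMajorant {f : X → ℝ} (hf : ContDiff ℝ 2 f) {p K : ℝ} (hp : 2 < p)
    {y : X} {c : ℝ} (hc : 0 ≤ c)
    (h : ∀ u, |taylorRem f y u| ≤ c * ‖u‖ ^ 2 + K * ‖u‖ ^ p) (u : X) :
    |taylorRem f y u| ≤ taylorMajorant f p K y * ‖u‖ ^ 2 + K * ‖u‖ ^ p := by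
  have hp0 : 0 ≤ p := by linarith
  refine (TopologicalSpace.denseRange_denseSeq X).induction_on
    (p := fun u => |taylorRem f y u| ≤ taylorMajorant f p K y * ‖u‖ ^ 2 + K * ‖u‖ ^ p) u ?_ ?_
  · refine isClosed_le ((continuous_taylorRem hf).comp (Continuous.prodMk_right y)).abs ?_
    exact (continuous_const.mul (continuous_norm.pow 2)).add
      (continuous_const.mul (continuous_norm.rpow_const fun _ => Or.inr hp0))
  · intro n
    set d := TopologicalSpace.denseSeq X n with hd
    by_cases h0 : d = 0
    · simp [h0, taylorRem_zero_right, Real.zero_rpow (by linarith : p ≠ 0)]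
    · have hbdd : BddAbove (range fun n : ℕ => max 0
          ((|taylorRem f y (TopologicalSpace.denseSeq X n)|
            - K * ‖TopologicalSpace.denseSeq X n‖ ^ p) / ‖TopologicalSpace.denseSeq X n‖ ^ 2)) :=
        ⟨c, by rintro _ ⟨m, rfl⟩; exact taylor_quotient_le hc (h _)⟩
      have h1 : (|taylorRem f y d| - K * ‖d‖ ^ p) / ‖d‖ ^ 2 ≤ taylorMajorant f p K y :=
        (le_max_right _ _).trans (le_ciSup hbdd n)
      have h2 : 0 < ‖d‖ ^ 2 := by positivity
      rw [div_le_iff₀ h2] at h1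
      linarith

lemma HessGrowth.tendsto_taylorMajorant {p C : ℝ} (hp : 2 < p) {f : X → ℝ}
    (hf : HessGrowth p C f) (y : X) :
    Tendsto (fun n : ℕ => taylorMajorant f p (C * 2 ^ (p - 2) + n) y) atTop (𝓝 0) := by
  have hp2 : 0 < p - 2 := by linarith
  rw [Metric.tendsto_atTop]
  intro ε hε
  obtain ⟨δ, hδ, hcont⟩ := Metric.continuous_iff.1 (continuous_hess hf.1) y ε hε
  set A := C * 2 ^ (p - 2) * (1 + ‖y‖) ^ (p - 2) with hA
  have hC1 : 0 ≤ C * 2 ^ (p - 2) := mul_nonneg hf.2.1 (by positivity)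
  obtain ⟨N, hN⟩ := exists_nat_ge (A / δ ^ (p - 2))
  refine ⟨N, fun n hn => ?_⟩
  have hδp : 0 < δ ^ (p - 2) := by positivity
  rw [div_le_iff₀ hδp] at hN
  rw [Real.dist_eq, sub_zero, abs_of_nonneg (taylorMajorant_nonneg _ _ _ _)]
  refine lt_of_le_of_lt (taylorMajorant_le (half_pos hε).le fun u => ?_) (half_lt_self hε)
  have hn' : (N : ℝ) ≤ n := by exact_mod_cast hn
  rcases lt_or_ge ‖u‖ δ with hu | hu
  · obtain ⟨s, hs, h⟩ := exists_abs_taylorRem_le hf.1 y u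
    have h1 : ‖hess f (y + s • u) - hess f y‖ < ε := by
      rw [← dist_eq_norm]
      apply hcont
      rw [dist_eq_norm, add_sub_cancel_left, norm_smul, Real.norm_of_nonneg hs.1.le]
      nlinarith [hs.2, norm_nonneg u]
    have h2 : 0 ≤ (C * 2 ^ (p - 2) + n) * ‖u‖ ^ p := by positivity
    have h3 : 2⁻¹ * ‖hess f (y + s • u) - hess f y‖ * ‖u‖ ^ 2 ≤ ε / 2 * ‖u‖ ^ 2 := by
      gcongr; linarith
    linarith
  · have h1 := hf.abs_taylorRem_le hp y u
    have h2 : δ ^ (p - 2) ≤ ‖u‖ ^ (p - 2) := by gcongr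
    have h3 : A ≤ n * ‖u‖ ^ (p - 2) := hN.trans (by gcongr)
    have h4 : A * ‖u‖ ^ 2 ≤ n * ‖u‖ ^ p := by
      rw [← rpow_sub_two_mul_sq (norm_nonneg u) hp, ← mul_assoc]
      gcongr
    have h5 : 0 ≤ ε / 2 * ‖u‖ ^ 2 := by positivity
    rw [hA] at h4
    nlinarith

lemma rpow_sub_two_rpow {a p : ℝ} (ha : 0 ≤ a) (hp : 2 < p) :
    (a ^ (p - 2)) ^ (p / (p - 2)) = a ^ p := by
  have : p - 2 ≠ 0 := by linarith
  rw [← Real.rpow_mul ha, mul_div_cancel₀ _ this]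

lemma integrable_rpow_of_le {p D : ℝ} (hp : 2 < p) {μ : Measure X}
    (hμ : Integrable (fun y : X => (1 + ‖y‖) ^ p) μ) {k : X → ℝ} (hk : Measurable k)
    (hk0 : ∀ y, 0 ≤ k y) (hD : 0 ≤ D) (hkD : ∀ y, k y ≤ D * (1 + ‖y‖) ^ (p - 2)) :
    Integrable (fun y => k y ^ (p / (p - 2))) μ := by
  refine (hμ.const_mul (D ^ (p / (p - 2)))).mono' (hk.pow_const _).aestronglyMeasurable
    (ae_of_all _ fun y => ?_)
  have hq : 0 ≤ p / (p - 2) := div_nonneg (by linarith) (by linarith)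
  rw [Real.norm_of_nonneg (Real.rpow_nonneg (hk0 y) _),
    ← rpow_sub_two_rpow (by positivity : (0 : ℝ) ≤ 1 + ‖y‖) hp,
    ← Real.mul_rpow hD (by positivity)]
  exact Real.rpow_le_rpow (hk0 y) (hkD y) hq

lemma HessGrowth.exists_taylor_bound {p C : ℝ} (hp : 2 < p) {f : X → ℝ} (hf : HessGrowth p C f)
    {μ : Measure X} (hμ : Integrable (fun y : X => (1 + ‖y‖) ^ p) μ) {ε : ℝ} (hε : 0 < ε) :
    ∃ (K : ℝ) (k : X → ℝ), 0 ≤ K ∧ Measurable k ∧ (∀ y, 0 ≤ k y) ∧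
      Integrable (fun y => k y ^ (p / (p - 2))) μ ∧
      (∫ y, k y ^ (p / (p - 2)) ∂μ) ^ ((p - 2) / p) ≤ ε ∧
      ∀ y u, |taylorRem f y u| ≤ k y * ‖u‖ ^ 2 + K * ‖u‖ ^ p := by
  have hC1 : 0 ≤ C * 2 ^ (p - 2) := mul_nonneg hf.2.1 (by positivity)
  have hp0 : 0 < p := by linarith
  have hp2 : 0 < p - 2 := by linarith
  have hq : 0 < p / (p - 2) := by positivity
  have hb : ∀ (n : ℕ) (y u : X), |taylorRem f y u| ≤
      C * 2 ^ (p - 2) * (1 + ‖y‖) ^ (p - 2) * ‖u‖ ^ 2 + (C * 2 ^ (p - 2) + n) * ‖u‖ ^ p := by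
    intro n y u
    have h1 := hf.abs_taylorRem_le hp y u
    have h2 : 0 ≤ (n : ℝ) * ‖u‖ ^ p := by positivity
    nlinarith
  have hle : ∀ (n : ℕ) (y : X), taylorMajorant f p (C * 2 ^ (p - 2) + n) y ≤
      C * 2 ^ (p - 2) * (1 + ‖y‖) ^ (p - 2) := fun n y =>
    taylorMajorant_le (by positivity) (hb n y)
  have hint := fun n : ℕ => integrable_rpow_of_le hp hμ
    (measurable_taylorMajorant hf.1 p (C * 2 ^ (p - 2) + n)) (taylorMajorant_nonneg _ _ _) hC1
    (hle n)
  have hlim : Tendsto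
      (fun n : ℕ => ∫ y, taylorMajorant f p (C * 2 ^ (p - 2) + n) y ^ (p / (p - 2)) ∂μ)
      atTop (𝓝 (∫ _, (0 : ℝ) ∂μ)) := by
    refine tendsto_integral_of_dominated_convergence
      (fun y => (C * 2 ^ (p - 2)) ^ (p / (p - 2)) * (1 + ‖y‖) ^ p)
      (fun n => (hint n).aestronglyMeasurable) (hμ.const_mul _) ?_ ?_
    · refine fun n => ae_of_all _ fun y => ?_
      rw [Real.norm_of_nonneg (Real.rpow_nonneg (taylorMajorant_nonneg _ _ _ _) _),
        ← rpow_sub_two_rpow (by positivity : (0 : ℝ) ≤ 1 + ‖y‖) hp,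
        ← Real.mul_rpow hC1 (by positivity)]
      exact Real.rpow_le_rpow (taylorMajorant_nonneg _ _ _ _) (hle n y) hq.le
    · refine ae_of_all _ fun y => ?_
      simpa [Real.zero_rpow hq.ne'] using
        (hf.tendsto_taylorMajorant hp y).rpow_const (p := p / (p - 2)) (Or.inr hq.le)
  have hlim' := hlim.rpow_const (p := (p - 2) / p) (Or.inr (by positivity))
  rw [integral_zero, Real.zero_rpow (by positivity)] at hlim'
  obtain ⟨n, hn⟩ := (hlim'.eventually (gt_mem_nhds hε)).exists
  exact ⟨C * 2 ^ (p - 2) + n, taylorMajorant f p (C * 2 ^ (p - 2) + n), by positivity,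
    measurable_taylorMajorant hf.1 _ _, taylorMajorant_nonneg _ _ _, hint n, hn.le,
    fun y u => abs_taylorRem_le_taylorMajorant hf.1 hp (by positivity) (hb n y) u⟩

lemma ofReal_norm_rpow (x : X) {p : ℝ} (hp : 0 ≤ p) :
    ENNReal.ofReal (‖x‖ ^ p) = (‖x‖₊ : ℝ≥0∞) ^ p := by
  rw [← ENNReal.ofReal_rpow_of_nonneg (norm_nonneg x) hp, ofReal_norm]; rfl

lemma integrable_norm_rpow_iff_lintegral {Ω : Type*} [MeasurableSpace Ω] {π : Measure Ω}
    {g : Ω → X} (hg : Measurable g) {p : ℝ} (hp : 0 ≤ p) :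
    Integrable (fun x => ‖g x‖ ^ p) π ↔ ∫⁻ x, (‖g x‖₊ : ℝ≥0∞) ^ p ∂π < ⊤ := by
  have hm : AEStronglyMeasurable (fun x => ‖g x‖ ^ p) π :=
    (hg.norm.pow_const p).aestronglyMeasurable
  rw [Integrable, and_iff_right hm, hasFiniteIntegral_iff_ofReal
    (ae_of_all _ fun x => Real.rpow_nonneg (norm_nonneg _) _)]
  simp only [ofReal_norm_rpow _ hp]

lemma ofReal_integral_norm_rpow {Ω : Type*} [MeasurableSpace Ω] {π : Measure Ω}
    {g : Ω → X} {p : ℝ} (hp : 0 ≤ p) (h : Integrable (fun x => ‖g x‖ ^ p) π) :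
    ENNReal.ofReal (∫ x, ‖g x‖ ^ p ∂π) = ∫⁻ x, (‖g x‖₊ : ℝ≥0∞) ^ p ∂π := by
  rw [ofReal_integral_eq_lintegral_ofReal h
    (ae_of_all _ fun x => Real.rpow_nonneg (norm_nonneg _) _)]
  simp only [ofReal_norm_rpow _ hp]

lemma integrable_one_add_norm_rpow {p : ℝ} (hp : 0 ≤ p) {μ : Measure X} (hμ : μ ∈ Pp (X := X) p) :
    Integrable (fun y : X => (1 + ‖y‖) ^ p) μ := by
  have := hμ.1
  have h := (integrable_norm_rpow_iff_lintegral measurable_id hp).2 hμ.2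
  refine (((integrable_const (1 : ℝ)).add h).const_mul (2 ^ p)).mono'
    ((measurable_norm.const_add 1).pow_const p).aestronglyMeasurable (ae_of_all _ fun y => ?_)
  rw [Real.norm_of_nonneg (by positivity)]
  simpa using add_rpow_le_two_rpow_mul zero_le_one (norm_nonneg y) hp

lemma integrable_id_of_mem_Pp {p : ℝ} (hp : 1 ≤ p) {μ : Measure X} (hμ : μ ∈ Pp (X := X) p) :
    Integrable (fun y : X => y) μ := by
  refine (integrable_one_add_norm_rpow (by linarith) hμ).mono'
    measurable_id.aestronglyMeasurable (ae_of_all _ fun y => ?_)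
  have h1 := Real.rpow_le_rpow_of_exponent_le
    (by linarith [norm_nonneg y] : (1 : ℝ) ≤ 1 + ‖y‖) hp
  rw [Real.rpow_one] at h1
  linarith

section Coupling

variable {p C : ℝ} {μ ν : Measure X} {π : Measure (X × X)} {f : X → ℝ}

lemma IsCoupling.integrable_comp_fst (h : IsCoupling μ ν π) {E : Type*} [NormedAddCommGroup E]
    {g : X → E} (hg : Integrable g μ) : Integrable (fun q : X × X => g q.1) π := by
  rw [← h.1] at hg
  exact hg.comp_measurable measurable_fst

lemma IsCoupling.integrable_comp_snd (h : IsCoupling μ ν π) {E : Type*} [NormedAddCommGroup E]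
    {g : X → E} (hg : Integrable g ν) : Integrable (fun q : X × X => g q.2) π := by
  rw [← h.2] at hg
  exact hg.comp_measurable measurable_snd

lemma IsCoupling.integral_comp_fst (h : IsCoupling μ ν π) {E : Type*} [NormedAddCommGroup E]
    [NormedSpace ℝ E] {g : X → E} (hg : AEStronglyMeasurable g μ) :
    ∫ q, g q.1 ∂π = ∫ y, g y ∂μ := by
  rw [← h.1] at hg ⊢
  exact (integral_map measurable_fst.aemeasurable hg).symm

lemma IsCoupling.integral_comp_snd (h : IsCoupling μ ν π) {E : Type*} [NormedAddCommGroup E]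
    [NormedSpace ℝ E] {g : X → E} (hg : AEStronglyMeasurable g ν) :
    ∫ q, g q.2 ∂π = ∫ y, g y ∂ν := by
  rw [← h.2] at hg ⊢
  exact (integral_map measurable_snd.aemeasurable hg).symm

lemma IsCoupling.isProbabilityMeasure [IsProbabilityMeasure μ] (h : IsCoupling μ ν π) :
    IsProbabilityMeasure π := by
  refine ⟨?_⟩
  have := congrArg (fun m : Measure X => m univ) h.1
  simpa [Measure.map_apply measurable_fst MeasurableSet.univ] using this

lemma IsCoupling.integrable_norm_sub_rpow (hp : 1 ≤ p) (hμ : μ ∈ Pp (X := X) p)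
    (hν : ν ∈ Pp (X := X) p) (h : IsCoupling μ ν π) :
    Integrable (fun q : X × X => ‖q.2 - q.1‖ ^ p) π := by
  have hp0 : 0 ≤ p := by linarith
  have h1 := h.integrable_comp_fst ((integrable_norm_rpow_iff_lintegral measurable_id hp0).2 hμ.2)
  have h2 := h.integrable_comp_snd ((integrable_norm_rpow_iff_lintegral measurable_id hp0).2 hν.2)
  refine ((h2.add h1).const_mul (2 ^ p)).mono'
    (((measurable_snd.sub measurable_fst).norm.pow_const p).aestronglyMeasurable)
    (ae_of_all _ fun q => ?_)
  rw [Real.norm_of_nonneg (by positivity)]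
  calc ‖q.2 - q.1‖ ^ p ≤ (‖q.2‖ + ‖q.1‖) ^ p := by gcongr; exact norm_sub_le _ _
    _ ≤ _ := add_rpow_le_two_rpow_mul (norm_nonneg _) (norm_nonneg _) hp0

lemma IsMartCoupling.integral_inner_eq_zero (hp : 1 ≤ p) (hμ : μ ∈ Pp (X := X) p)
    (hν : ν ∈ Pp (X := X) p) (h : IsMartCoupling μ ν π) {g : X → X} (hg : Measurable g)
    (hint : Integrable (fun q : X × X => ⟪g q.1, q.2 - q.1⟫) π) :
    ∫ q, ⟪g q.1, q.2 - q.1⟫ ∂π = 0 := by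
  have := hμ.1
  have := h.1.isProbabilityMeasure
  have h1 := h.1.integrable_comp_fst (integrable_id_of_mem_Pp hp hμ)
  have h2 := h.1.integrable_comp_snd (integrable_id_of_mem_Pp hp hν)
  have hpre : ∀ B : Set X, MeasurableSet B → MeasurableSet (Prod.fst ⁻¹' B : Set (X × X)) :=
    fun B hB => measurable_fst hB
  set m : MeasurableSpace (X × X) := MeasurableSpace.comap Prod.fst inferInstance with hm
  have hle : m ≤ Prod.instMeasurableSpace := measurable_fst.comap_le
  have hzero : (0 : X × X → X) =ᵐ[π] π[fun q : X × X => q.2 - q.1 | m] := by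
    refine ae_eq_condExp_of_forall_setIntegral_eq hle (h2.sub h1)
      (fun s _ _ => (integrable_zero _ _ _).integrableOn) ?_
      stronglyMeasurable_zero.aestronglyMeasurable
    rintro s ⟨B, hB, rfl⟩ -
    have hS := hpre B hB
    have e1 : ∫ q in Prod.fst ⁻¹' B, q.2 ∂π = ∫ y in B, y ∂μ := by
      rw [← integral_indicator hS, ← integral_indicator hB]
      convert h.2 B hB using 2
      · ext q
        by_cases hq : q.1 ∈ B <;> simp [hq]
      · ext y
        by_cases hy : y ∈ B <;> simp [hy]
    have e2 : ∫ q in Prod.fst ⁻¹' B, q.1 ∂π = ∫ y in B, y ∂μ := by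
      rw [← integral_indicator hS, ← integral_indicator hB]
      exact h.1.integral_comp_fst (g := B.indicator fun y => y)
        (measurable_id.indicator hB).aestronglyMeasurable
    rw [integral_sub h2.integrableOn h1.integrableOn, e1, e2]
    simp
  have hpull : π[fun q : X × X => ⟪g q.1, q.2 - q.1⟫ | m] =ᵐ[π]
      fun q => ⟪g q.1, (π[fun q : X × X => q.2 - q.1 | m]) q⟫ :=
    condExp_bilin_of_stronglyMeasurable_left (m := m) (μ := π) (innerSL ℝ (E := X))
    (f := fun q : X × X => g q.1) (g := fun q : X × X => q.2 - q.1)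
    (hg.stronglyMeasurable.comp_measurable (comap_measurable _)) hint (h2.sub h1)
  have e := integral_condExp (μ := π) (f := fun q : X × X => ⟪g q.1, q.2 - q.1⟫) hle
  rw [← e]
  refine integral_eq_zero_of_ae ?_
  filter_upwards [hpull, hzero] with q hq hq0
  rw [hq, ← hq0]
  simp

lemma IsCoupling.integrable_mul_sq (hp : 2 < p) (h : IsCoupling μ ν π) {k : X → ℝ}
    (hk : Measurable k) (hk0 : ∀ y, 0 ≤ k y)
    (hkint : Integrable (fun y => k y ^ (p / (p - 2))) μ)
    (hπ : Integrable (fun q : X × X => ‖q.2 - q.1‖ ^ p) π) :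
    Integrable (fun q : X × X => k q.1 * ‖q.2 - q.1‖ ^ 2) π ∧
      ∫ q, k q.1 * ‖q.2 - q.1‖ ^ 2 ∂π ≤ (∫ y, k y ^ (p / (p - 2)) ∂μ) ^ ((p - 2) / p) *
        (∫ q, ‖q.2 - q.1‖ ^ p ∂π) ^ (2 / p) := by
  have hp2 : 0 < p - 2 := by linarith
  have hp0 : 0 < p := by linarith
  have hq : 0 < p / (p - 2) := by positivity
  have hq2 : 0 < p / 2 := by positivity
  have hconj : (p / (p - 2)).HolderConjugate (p / 2) := by
    rw [Real.holderConjugate_iff]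
    constructor
    · rw [lt_div_iff₀ hp2]; linarith
    · field_simp; ring
  have hsq : ∀ q : X × X, (‖q.2 - q.1‖ ^ 2) ^ (p / 2) = ‖q.2 - q.1‖ ^ p := by
    intro q
    rw [← Real.rpow_two, ← Real.rpow_mul (norm_nonneg _)]
    congr 1; ring
  have hm1 : Measurable fun q : X × X => k q.1 := hk.comp measurable_fst
  have hm2 : Measurable fun q : X × X => ‖q.2 - q.1‖ ^ 2 :=
    (measurable_snd.sub measurable_fst).norm.pow_const 2
  have hL1 : MemLp (fun q : X × X => k q.1) (ENNReal.ofReal (p / (p - 2))) π := by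
    rw [← integrable_norm_rpow_iff hm1.aestronglyMeasurable (by simpa using hq)
      ENNReal.ofReal_ne_top, ENNReal.toReal_ofReal hq.le]
    simpa only [Real.norm_of_nonneg (hk0 _)] using h.integrable_comp_fst hkint
  have hL2 : MemLp (fun q : X × X => ‖q.2 - q.1‖ ^ 2) (ENNReal.ofReal (p / 2)) π := by
    rw [← integrable_norm_rpow_iff hm2.aestronglyMeasurable (by simpa using hq2)
      ENNReal.ofReal_ne_top, ENNReal.toReal_ofReal hq2.le]
    simpa only [norm_pow, norm_norm, hsq] using hπ
  constructor
  · have := hconj.ennrealOfReal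
    exact hL1.integrable_mul hL2
  · have := integral_mul_le_Lp_mul_Lq_of_nonneg hconj (ae_of_all _ fun q => hk0 q.1)
      (ae_of_all _ fun q : X × X => by positivity) hL1 hL2
    simp only [hsq, one_div, inv_div] at this
    rwa [h.integral_comp_fst hkint.aestronglyMeasurable] at this

lemma HessGrowth.integrable (hp : 2 < p) (hf : HessGrowth p C f) (hμ : μ ∈ Pp (X := X) p) :
    Integrable f μ := by
  obtain ⟨D, hD⟩ := hf.abs_le hp
  exact ((integrable_one_add_norm_rpow (by linarith) hμ).const_mul D).mono'
    hf.1.continuous.measurable.aestronglyMeasurable (ae_of_all _ hD)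

lemma HessGrowth.integrable_inner_hess (hp : 2 < p) (hf : HessGrowth p C f)
    (hμ : μ ∈ Pp (X := X) p) (hν : ν ∈ Pp (X := X) p) (h : IsCoupling μ ν π) :
    Integrable (fun q : X × X => ⟪q.2 - q.1, hess f q.1 (q.2 - q.1)⟫) π := by
  have hk : Measurable fun y : X => C * (1 + ‖y‖) ^ (p - 2) :=
    ((measurable_norm.const_add 1).pow_const _).const_mul C
  have hk0 : ∀ y : X, 0 ≤ C * (1 + ‖y‖) ^ (p - 2) := fun y =>
    mul_nonneg hf.2.1 (by positivity)
  have hi := integrable_rpow_of_le hp (integrable_one_add_norm_rpow (by linarith) hμ) hk hk0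
    hf.2.1 (fun _ => le_rfl)
  refine (h.integrable_mul_sq hp hk hk0 hi (h.integrable_norm_sub_rpow (by linarith) hμ hν)).1.mono'
    ?_ (ae_of_all _ fun q => hf.abs_hess_le _ _)
  have := continuous_hess hf.1
  exact (by fun_prop : Continuous fun q : X × X =>
    ⟪q.2 - q.1, hess f q.1 (q.2 - q.1)⟫).measurable.aestronglyMeasurable

lemma HessGrowth.abs_integral_sub_le (hp : 2 < p) (hf : HessGrowth p C f)
    (hμ : μ ∈ Pp (X := X) p) {ε K : ℝ} {k : X → ℝ} (hk : Measurable k) (hk0 : ∀ y, 0 ≤ k y)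
    (hkint : Integrable (fun y => k y ^ (p / (p - 2))) μ)
    (hkε : (∫ y, k y ^ (p / (p - 2)) ∂μ) ^ ((p - 2) / p) ≤ ε)
    (hrem : ∀ y u, |taylorRem f y u| ≤ k y * ‖u‖ ^ 2 + K * ‖u‖ ^ p)
    (hν : ν ∈ Pp (X := X) p) (h : IsMartCoupling μ ν π) :
    |∫ x, f x ∂ν - ∫ x, f x ∂μ - 2⁻¹ * ∫ q, ⟪q.2 - q.1, hess f q.1 (q.2 - q.1)⟫ ∂π| ≤
      ε * (∫ q, ‖q.2 - q.1‖ ^ p ∂π) ^ (2 / p) + K * ∫ q, ‖q.2 - q.1‖ ^ p ∂π := by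
  have hp1 : 1 ≤ p := by linarith
  have hπ := h.1.integrable_norm_sub_rpow hp1 hμ hν
  obtain ⟨hi1, hi2⟩ := h.1.integrable_mul_sq hp hk hk0 hkint hπ
  have hH := hf.integrable_inner_hess hp hμ hν h.1
  have hfμ := hf.integrable hp hμ
  have hfν := hf.integrable hp hν
  have hg := continuous_gradient hf.1
  have hG : Integrable (fun q : X × X => ⟪gradient f q.1, q.2 - q.1⟫) π := by
    refine (((h.1.integrable_comp_fst (integrable_one_add_norm_rpow (by linarith) hμ)).add
      hπ).const_mul (‖gradient f 0‖ + C)).mono'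
      (by fun_prop : Continuous fun q : X × X =>
        ⟪gradient f q.1, q.2 - q.1⟫).measurable.aestronglyMeasurable (ae_of_all _ fun q => ?_)
    have h1 := rpow_mul_rpow_le_add (by positivity : 0 ≤ 1 + ‖q.1‖) (norm_nonneg (q.2 - q.1))
      (by linarith : 0 ≤ p - 1) zero_le_one (by linarith)
    rw [Real.rpow_one, sub_add_cancel] at h1
    calc |⟪gradient f q.1, q.2 - q.1⟫| ≤ ‖gradient f q.1‖ * ‖q.2 - q.1‖ :=
          abs_real_inner_le_norm _ _
      _ ≤ (‖gradient f 0‖ + C) * (1 + ‖q.1‖) ^ (p - 1) * ‖q.2 - q.1‖ := by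
          gcongr; exact hf.norm_gradient_le hp _
      _ = (‖gradient f 0‖ + C) * ((1 + ‖q.1‖) ^ (p - 1) * ‖q.2 - q.1‖) := by ring
      _ ≤ _ := by
          have := hf.2.1
          gcongr
          exact h1
  have hG0 := h.integral_inner_eq_zero hp1 hμ hν hg.measurable hG
  have e : ∫ q, taylorRem f q.1 (q.2 - q.1) ∂π =
      ∫ x, f x ∂ν - ∫ x, f x ∂μ - 2⁻¹ * ∫ q, ⟪q.2 - q.1, hess f q.1 (q.2 - q.1)⟫ ∂π := by
    have h1 := h.1.integrable_comp_fst hfμ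
    have h2 := h.1.integrable_comp_snd hfν
    simp only [taylorRem, add_sub_cancel]
    have h3 : Integrable (fun q : X × X => f q.2 - f q.1) π := h2.sub h1
    have h4 : Integrable (fun q : X × X => f q.2 - f q.1 - ⟪gradient f q.1, q.2 - q.1⟫) π :=
      h3.sub hG
    rw [integral_sub h4 (hH.const_mul _), integral_sub h3 hG,
      integral_sub h2 h1, hG0, integral_const_mul, h.1.integral_comp_fst hfμ.aestronglyMeasurable,
      h.1.integral_comp_snd hfν.aestronglyMeasurable, sub_zero]
  have hi : Integrable (fun q : X × X => k q.1 * ‖q.2 - q.1‖ ^ 2 + K * ‖q.2 - q.1‖ ^ p) π :=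
    hi1.add (hπ.const_mul K)
  rw [← e]
  calc |∫ q, taylorRem f q.1 (q.2 - q.1) ∂π|
      ≤ ∫ q, (k q.1 * ‖q.2 - q.1‖ ^ 2 + K * ‖q.2 - q.1‖ ^ p) ∂π := by
        rw [← Real.norm_eq_abs]
        exact norm_integral_le_of_norm_le hi (ae_of_all _ fun q => hrem _ _)
    _ = ∫ q, k q.1 * ‖q.2 - q.1‖ ^ 2 ∂π + K * ∫ q, ‖q.2 - q.1‖ ^ p ∂π := by
        rw [integral_add hi1 (hπ.const_mul K), integral_const_mul]
    _ ≤ _ := by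
        gcongr
        refine hi2.trans ?_
        have : 0 ≤ ∫ q, ‖q.2 - q.1‖ ^ p ∂π := integral_nonneg fun q => by positivity
        gcongr

end Coupling

section HessMax

variable {p C : ℝ} {f : X → ℝ}

lemma inner_hess_le_norm (f : X → ℝ) (y : X) {w : X} (hw : ‖w‖ ≤ 1) :
    ⟪w, hess f y w⟫ ≤ ‖hess f y‖ := by
  calc ⟪w, hess f y w⟫ ≤ ‖w‖ * ‖hess f y w‖ := real_inner_le_norm _ _
    _ ≤ ‖w‖ * (‖hess f y‖ * ‖w‖) := by gcongr; exact ContinuousLinearMap.le_opNorm _ _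
    _ ≤ 1 * (‖hess f y‖ * 1) := by gcongr
    _ = _ := by ring

lemma bddAbove_inner_hess (f : X → ℝ) (y : X) :
    BddAbove ((fun w : X => ⟪w, hess f y w⟫) '' {w : X | ‖w‖ ≤ 1}) :=
  ⟨‖hess f y‖, by rintro _ ⟨w, hw, rfl⟩; exact inner_hess_le_norm f y hw⟩

lemma inner_hess_le_hessMax (f : X → ℝ) (y : X) {w : X} (hw : ‖w‖ ≤ 1) :
    ⟪w, hess f y w⟫ ≤ hessMax f y :=
  le_csSup (bddAbove_inner_hess f y) ⟨w, hw, rfl⟩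

lemma hessMax_nonneg (f : X → ℝ) (y : X) : 0 ≤ hessMax f y := by
  simpa using inner_hess_le_hessMax f y (w := 0) (by simp)

lemma hessMax_le_norm (f : X → ℝ) (y : X) : hessMax f y ≤ ‖hess f y‖ :=
  csSup_le ⟨_, 0, by simp, rfl⟩ (by rintro _ ⟨w, hw, rfl⟩; exact inner_hess_le_norm f y hw)

lemma inner_hess_le_hessMax_mul (f : X → ℝ) (y u : X) :
    ⟪u, hess f y u⟫ ≤ hessMax f y * ‖u‖ ^ 2 := by
  by_cases hu : u = 0
  · simp [hu]
  have hu' : 0 < ‖u‖ := norm_pos_iff.2 hu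
  have h := inner_hess_le_hessMax f y (w := ‖u‖⁻¹ • u)
    (by rw [norm_smul, norm_inv, norm_norm, inv_mul_cancel₀ hu'.ne'])
  rw [map_smul, real_inner_smul_left, real_inner_smul_right] at h
  calc ⟪u, hess f y u⟫ = ‖u‖⁻¹ * (‖u‖⁻¹ * ⟪u, hess f y u⟫) * ‖u‖ ^ 2 := by field_simp
    _ ≤ _ := by gcongr

/-- A dense sequence in the closed unit ball. -/
def unitBallSeq (X : Type*) [NormedAddCommGroup X] [SecondCountableTopology X] (n : ℕ) : X :=
  haveI : Nonempty (Metric.closedBall (0 : X) 1) := ⟨⟨0, by simp⟩⟩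
  (TopologicalSpace.denseSeq (Metric.closedBall (0 : X) 1) n : X)

lemma norm_unitBallSeq_le (n : ℕ) : ‖unitBallSeq X n‖ ≤ 1 := by
  unfold unitBallSeq
  exact mem_closedBall_zero_iff.1 (Subtype.property _)

lemma lt_hessMax_iff (f : X → ℝ) (y : X) {c : ℝ} :
    c < hessMax f y ↔ ∃ n, c < ⟪unitBallSeq X n, hess f y (unitBallSeq X n)⟫ := by
  constructor
  · intro h
    have : Nonempty (Metric.closedBall (0 : X) 1) := ⟨⟨0, by simp⟩⟩
    obtain ⟨_, ⟨w, hw, rfl⟩, hc⟩ := exists_lt_of_lt_csSup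
      (s := (fun w : X => ⟪w, hess f y w⟫) '' {w : X | ‖w‖ ≤ 1}) ⟨_, 0, by simp, rfl⟩ h
    have hopen : IsOpen {w : Metric.closedBall (0 : X) 1 | c < ⟪(w : X), hess f y w⟫} :=
      isOpen_lt continuous_const (by fun_prop)
    exact (TopologicalSpace.denseRange_denseSeq (Metric.closedBall (0 : X) 1)).exists_mem_open
      hopen ⟨⟨w, by simpa using hw⟩, hc⟩
  · rintro ⟨n, hn⟩
    exact hn.trans_le (inner_hess_le_hessMax f y (norm_unitBallSeq_le n))

lemma continuous_inner_hess_const (hf : ContDiff ℝ 2 f) (w : X) :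
    Continuous fun y => ⟪w, hess f y w⟫ := by
  have := continuous_hess hf
  fun_prop

lemma measurable_hessMax (hf : ContDiff ℝ 2 f) : Measurable (hessMax f) := by
  refine measurable_of_Ioi fun c => ?_
  have : hessMax f ⁻¹' Ioi c =
      ⋃ n, {y | c < ⟪unitBallSeq X n, hess f y (unitBallSeq X n)⟫} := by
    ext y
    simp [lt_hessMax_iff]
  rw [this]
  exact MeasurableSet.iUnion fun n =>
    (isOpen_lt continuous_const (continuous_inner_hess_const hf _)).measurableSet

lemma exists_measurable_direction (hf : ContDiff ℝ 2 f) {ε : ℝ} (hε : 0 < ε) :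
    ∃ w : X → X, Measurable w ∧ (∀ y, ‖w y‖ ≤ 1) ∧
      ∀ y, (1 - ε) * hessMax f y ≤ ⟪w y, hess f y (w y)⟫ := by
  classical
  have hex : ∀ y, ∃ n, hessMax f y = 0 ∨
      (1 - ε) * hessMax f y < ⟪unitBallSeq X n, hess f y (unitBallSeq X n)⟫ := by
    intro y
    by_cases h0 : hessMax f y = 0
    · exact ⟨0, Or.inl h0⟩
    · have : 0 < hessMax f y := lt_of_le_of_ne (hessMax_nonneg f y) (Ne.symm h0)
      obtain ⟨n, hn⟩ := (lt_hessMax_iff f y (c := (1 - ε) * hessMax f y)).1 (by nlinarith)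
      exact ⟨n, Or.inr hn⟩
  have hmeas := measurable_hessMax hf
  have hfind : Measurable fun y => Nat.find (hex y) := by
    refine measurable_find hex fun n => ?_
    exact (measurableSet_eq_fun hmeas measurable_const).union
      (measurableSet_lt (hmeas.const_mul _) (continuous_inner_hess_const hf _).measurable)
  have hzero : MeasurableSet {y | hessMax f y = 0} := measurableSet_eq_fun hmeas measurable_const
  refine ⟨fun y => if hessMax f y = 0 then 0 else unitBallSeq X (Nat.find (hex y)),
    Measurable.ite hzero measurable_const
      ((measurable_from_nat (f := unitBallSeq X)).comp hfind), fun y => ?_, fun y => ?_⟩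
  · dsimp only
    split_ifs
    · simp
    · exact norm_unitBallSeq_le _
  · dsimp only
    split_ifs with h0
    · simp [h0]
    · exact ((Nat.find_spec (hex y)).resolve_left h0).le

lemma HessGrowth.integrable_hessMax_rpow (hp : 2 < p) (hf : HessGrowth p C f) {μ : Measure X}
    (hμ : Integrable (fun y : X => (1 + ‖y‖) ^ p) μ) :
    Integrable (fun y => hessMax f y ^ (p / (p - 2))) μ :=
  integrable_rpow_of_le hp hμ (measurable_hessMax hf.1) (hessMax_nonneg f) hf.2.1
    fun y => (hessMax_le_norm f y).trans (hf.2.2 y)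

lemma HessGrowth.exists_perturbation (hp : 2 < p) (hf : HessGrowth p C f) {μ : Measure X}
    (hμ : Integrable (fun y : X => (1 + ‖y‖) ^ p) μ) {ε t : ℝ} (hε : 0 < ε) (hε1 : ε ≤ 1)
    (ht : 0 ≤ t) :
    ∃ θ : X → X, Measurable θ ∧ Integrable (fun y => ‖θ y‖ ^ p) μ ∧ ∫ y, ‖θ y‖ ^ p ∂μ ≤ t ^ p ∧
      Integrable (fun y => ⟪θ y, hess f y (θ y)⟫) μ ∧
      (1 - ε) * (∫ y, hessMax f y ^ (p / (p - 2)) ∂μ) ^ ((p - 2) / p) * t ^ 2 ≤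
        ∫ y, ⟪θ y, hess f y (θ y)⟫ ∂μ := by
  have hp2 : 0 < p - 2 := by linarith
  have hp0 : 0 < p := by linarith
  have hint := hf.integrable_hessMax_rpow hp hμ
  have hA0 : 0 ≤ ∫ y, hessMax f y ^ (p / (p - 2)) ∂μ :=
    integral_nonneg fun y => Real.rpow_nonneg (hessMax_nonneg f y) _
  set A := ∫ y, hessMax f y ^ (p / (p - 2)) ∂μ with hA
  rcases hA0.eq_or_lt with h0 | hpos
  · refine ⟨fun _ => 0, measurable_const, ?_, ?_, ?_, ?_⟩
    · simp [Real.zero_rpow hp0.ne']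
    · simpa [Real.zero_rpow hp0.ne'] using Real.rpow_nonneg ht p
    · simp
    · rw [← h0, Real.zero_rpow (by positivity)]; simp
  obtain ⟨w, hw, hw1, hwH⟩ := exists_measurable_direction hf.1 hε
  set s := t * A ^ (-(1 / p)) with hs
  have hs0 : 0 ≤ s := by positivity
  have hsp : s ^ p * A = t ^ p := by
    rw [hs, Real.mul_rpow ht (by positivity), ← Real.rpow_mul hA0,
      show -(1 / p) * p = -1 by field_simp, Real.rpow_neg_one, mul_assoc,
      inv_mul_cancel₀ hpos.ne', mul_one]
  have hs2 : s ^ 2 * A = A ^ ((p - 2) / p) * t ^ 2 := by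
    have : A ^ ((p - 2) / p) = (A ^ (-(1 / p))) ^ 2 * A := by
      rw [← Real.rpow_natCast, ← Real.rpow_mul hA0, ← Real.rpow_add_one hpos.ne']
      congr 1; field_simp; push_cast; ring
    rw [this, hs]; ring
  have hm := hessMax_nonneg f
  have hnorm : ∀ y, ‖(s * hessMax f y ^ (1 / (p - 2))) • w y‖ ^ p ≤
      s ^ p * hessMax f y ^ (p / (p - 2)) := by
    intro y
    have hb : 0 ≤ hessMax f y ^ (1 / (p - 2)) := Real.rpow_nonneg (hm y) _
    rw [norm_smul, Real.norm_of_nonneg (mul_nonneg hs0 hb)]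
    calc (s * hessMax f y ^ (1 / (p - 2)) * ‖w y‖) ^ p
        ≤ (s * hessMax f y ^ (1 / (p - 2))) ^ p := by
          refine Real.rpow_le_rpow (by positivity) ?_ hp0.le
          exact mul_le_of_le_one_right (by positivity) (hw1 y)
      _ = _ := by
          rw [Real.mul_rpow hs0 hb, ← Real.rpow_mul (hm y)]
          congr 2; ring
  have hpow : ∀ y, (hessMax f y ^ (1 / (p - 2))) ^ 2 * hessMax f y =
      hessMax f y ^ (p / (p - 2)) := by
    intro y
    have e : p / (p - 2) = 1 / (p - 2) * 2 + 1 := by field_simp; ring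
    have e0 : 1 / (p - 2) * 2 + 1 ≠ 0 := by positivity
    rw [e, Real.rpow_add_one' (hm y) e0, Real.rpow_mul (hm y), Real.rpow_two]
  have hinner : ∀ y, ⟪(s * hessMax f y ^ (1 / (p - 2))) • w y,
      hess f y ((s * hessMax f y ^ (1 / (p - 2))) • w y)⟫ =
      s ^ 2 * (hessMax f y ^ (1 / (p - 2))) ^ 2 * ⟪w y, hess f y (w y)⟫ := by
    intro y
    rw [map_smul, real_inner_smul_left, real_inner_smul_right]; ring
  have hlow : ∀ y, (1 - ε) * s ^ 2 * hessMax f y ^ (p / (p - 2)) ≤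
      ⟪(s * hessMax f y ^ (1 / (p - 2))) • w y,
        hess f y ((s * hessMax f y ^ (1 / (p - 2))) • w y)⟫ := by
    intro y
    rw [hinner, ← hpow]
    calc _ = s ^ 2 * (hessMax f y ^ (1 / (p - 2))) ^ 2 * ((1 - ε) * hessMax f y) := by ring
      _ ≤ _ := by gcongr; exact hwH y
  have hup : ∀ y, ⟪(s * hessMax f y ^ (1 / (p - 2))) • w y,
        hess f y ((s * hessMax f y ^ (1 / (p - 2))) • w y)⟫ ≤
      s ^ 2 * hessMax f y ^ (p / (p - 2)) := by
    intro y
    rw [hinner, ← hpow, ← mul_assoc]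
    gcongr
    exact inner_hess_le_hessMax f y (hw1 y)
  have hθ : Measurable fun y => (s * hessMax f y ^ (1 / (p - 2))) • w y :=
    (((measurable_hessMax hf.1).pow_const _).const_mul s).smul hw
  have hi1 : Integrable (fun y => ‖(s * hessMax f y ^ (1 / (p - 2))) • w y‖ ^ p) μ := by
    refine (hint.const_mul (s ^ p)).mono' (hθ.norm.pow_const p).aestronglyMeasurable
      (ae_of_all _ fun y => ?_)
    rw [Real.norm_of_nonneg (by positivity)]
    exact hnorm y
  have hi2 : Integrable (fun y => ⟪(s * hessMax f y ^ (1 / (p - 2))) • w y,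
        hess f y ((s * hessMax f y ^ (1 / (p - 2))) • w y)⟫) μ := by
    have hc : Continuous fun q : X × X => ⟪q.2, hess f q.1 q.2⟫ := by
      have := continuous_hess hf.1
      fun_prop
    refine (hint.const_mul (s ^ 2)).mono'
      (hc.measurable.comp (measurable_id.prodMk hθ)).aestronglyMeasurable
      (ae_of_all _ fun y => ?_)
    have h0 : 0 ≤ (1 - ε) * s ^ 2 * hessMax f y ^ (p / (p - 2)) :=
      mul_nonneg (mul_nonneg (by linarith) (by positivity)) (Real.rpow_nonneg (hm y) _)
    rw [Real.norm_of_nonneg (h0.trans (hlow y))]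
    exact hup y
  refine ⟨_, hθ, hi1, ?_, hi2, ?_⟩
  · calc _ ≤ ∫ y, s ^ p * hessMax f y ^ (p / (p - 2)) ∂μ :=
          integral_mono hi1 (hint.const_mul _) hnorm
      _ = t ^ p := by rw [integral_const_mul, hsp]
  · calc _ = ∫ y, (1 - ε) * s ^ 2 * hessMax f y ^ (p / (p - 2)) ∂μ := by
          rw [integral_const_mul, ← hA, mul_assoc, mul_assoc, hs2]
      _ ≤ _ := integral_mono (hint.const_mul _) hi2 hlow

end HessMax

section Perturbation

variable {p : ℝ} {μ : Measure X} {θ : X → X}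

/-- The coupling of `μ` and `muMart μ θ` that moves `y` to `y + θ y` or to `y - θ y`, with
probability one half each. -/
def martCoupling (μ : Measure X) (θ : X → X) : Measure (X × X) :=
  (2 : ℝ≥0∞)⁻¹ • μ.map (fun y => (y, y + θ y)) + (2 : ℝ≥0∞)⁻¹ • μ.map (fun y => (y, y - θ y))

lemma integrable_martCoupling {E : Type*} [NormedAddCommGroup E] (hθ : Measurable θ)
    {g : X × X → E} (hg : StronglyMeasurable g) (h1 : Integrable (fun y => g (y, y + θ y)) μ)
    (h2 : Integrable (fun y => g (y, y - θ y)) μ) : Integrable g (martCoupling μ θ) := by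
  have m1 : Measurable fun y => (y, y + θ y) := measurable_id.prodMk (measurable_id.add hθ)
  have m2 : Measurable fun y => (y, y - θ y) := measurable_id.prodMk (measurable_id.sub hθ)
  exact (((integrable_map_measure hg.aestronglyMeasurable m1.aemeasurable).2 h1).smul_measure
    (by simp)).add_measure
    (((integrable_map_measure hg.aestronglyMeasurable m2.aemeasurable).2 h2).smul_measure (by simp))

lemma integral_martCoupling {E : Type*} [NormedAddCommGroup E] [NormedSpace ℝ E]
    (hθ : Measurable θ)
    {g : X × X → E} (hg : StronglyMeasurable g) (h1 : Integrable (fun y => g (y, y + θ y)) μ)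
    (h2 : Integrable (fun y => g (y, y - θ y)) μ) :
    ∫ q, g q ∂(martCoupling μ θ) =
      (2 : ℝ)⁻¹ • ∫ y, g (y, y + θ y) ∂μ + (2 : ℝ)⁻¹ • ∫ y, g (y, y - θ y) ∂μ := by
  have m1 : Measurable fun y => (y, y + θ y) := measurable_id.prodMk (measurable_id.add hθ)
  have m2 : Measurable fun y => (y, y - θ y) := measurable_id.prodMk (measurable_id.sub hθ)
  have i1 := ((integrable_map_measure hg.aestronglyMeasurable m1.aemeasurable).2 h1).smul_measure
    (c := (2 : ℝ≥0∞)⁻¹) (by simp)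
  have i2 := ((integrable_map_measure hg.aestronglyMeasurable m2.aemeasurable).2 h2).smul_measure
    (c := (2 : ℝ≥0∞)⁻¹) (by simp)
  rw [martCoupling, integral_add_measure i1 i2, integral_smul_measure, integral_smul_measure,
    integral_map m1.aemeasurable hg.aestronglyMeasurable,
    integral_map m2.aemeasurable hg.aestronglyMeasurable]
  simp

lemma isCoupling_martCoupling (hθ : Measurable θ) :
    IsCoupling μ (muMart μ θ) (martCoupling μ θ) := by
  have m1 : Measurable fun y => (y, y + θ y) := measurable_id.prodMk (measurable_id.add hθ)
  have m2 : Measurable fun y => (y, y - θ y) := measurable_id.prodMk (measurable_id.sub hθ)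
  constructor
  · rw [martCoupling, Measure.map_add _ _ measurable_fst, Measure.map_smul, Measure.map_smul,
      Measure.map_map measurable_fst m1, Measure.map_map measurable_fst m2]
    have : (Prod.fst ∘ fun y => (y, y + θ y)) = id := rfl
    have : (Prod.fst ∘ fun y => (y, y - θ y)) = id := rfl
    simp only [*, Measure.map_id, ← add_smul, ENNReal.inv_two_add_inv_two, one_smul]
  · rw [martCoupling, Measure.map_add _ _ measurable_snd, Measure.map_smul, Measure.map_smul,
      Measure.map_map measurable_snd m1, Measure.map_map measurable_snd m2]
    rfl

lemma integrable_norm_add_rpow (hp : 0 ≤ p) {g₁ g₂ : X → X} (h₁ : Measurable g₁)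
    (h₂ : Measurable g₂) (hi₁ : Integrable (fun y => ‖g₁ y‖ ^ p) μ)
    (hi₂ : Integrable (fun y => ‖g₂ y‖ ^ p) μ) :
    Integrable (fun y => ‖g₁ y + g₂ y‖ ^ p) μ := by
  refine ((hi₁.add hi₂).const_mul (2 ^ p)).mono'
    ((h₁.add h₂).norm.pow_const p).aestronglyMeasurable (ae_of_all _ fun y => ?_)
  rw [Real.norm_of_nonneg (by positivity)]
  calc ‖g₁ y + g₂ y‖ ^ p ≤ (‖g₁ y‖ + ‖g₂ y‖) ^ p := by gcongr; exact norm_add_le _ _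
    _ ≤ _ := add_rpow_le_two_rpow_mul (norm_nonneg _) (norm_nonneg _) hp

lemma muMart_mem_Pp (hp : 0 ≤ p) (hμ : μ ∈ Pp (X := X) p) (hθ : Measurable θ)
    (hi : Integrable (fun y => ‖θ y‖ ^ p) μ) : muMart μ θ ∈ Pp (X := X) p := by
  have hprob := hμ.1
  have hc := isCoupling_martCoupling (μ := μ) hθ
  have hμi := (integrable_norm_rpow_iff_lintegral measurable_id hp).2 hμ.2
  have hadd := integrable_norm_add_rpow hp measurable_id hθ hμi hi
  have hsub := integrable_norm_add_rpow hp measurable_id hθ.neg hμi (by simpa using hi)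
  have hm : Measurable fun q : X × X => ‖q.2‖ ^ p := measurable_snd.norm.pow_const p
  have hint : Integrable (fun q : X × X => ‖q.2‖ ^ p) (martCoupling μ θ) :=
    integrable_martCoupling hθ hm.stronglyMeasurable hadd (by simpa [sub_eq_add_neg] using hsub)
  have := hc.isProbabilityMeasure
  constructor
  · rw [← hc.2]
    exact Measure.isProbabilityMeasure_map measurable_snd.aemeasurable
  · refine (integrable_norm_rpow_iff_lintegral measurable_id hp).1 ?_
    rw [← hc.2, integrable_map_measure (measurable_id.norm.pow_const p).aestronglyMeasurable
        measurable_snd.aemeasurable]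
    exact hint

lemma isMartCoupling_martCoupling (hp : 1 ≤ p) (hμ : μ ∈ Pp (X := X) p) (hθ : Measurable θ)
    (hi : Integrable (fun y => ‖θ y‖ ^ p) μ) :
    IsMartCoupling μ (muMart μ θ) (martCoupling μ θ) := by
  refine ⟨isCoupling_martCoupling hθ, fun B hB => ?_⟩
  have := hμ.1
  have hμi := integrable_id_of_mem_Pp hp hμ
  have hθi : Integrable θ μ := by
    refine ((integrable_const (1 : ℝ)).add hi).mono' hθ.aestronglyMeasurable
      (ae_of_all _ fun y => ?_)
    have h := rpow_mul_rpow_le_add zero_le_one (norm_nonneg (θ y)) (by linarith : 0 ≤ p - 1)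
      zero_le_one (by linarith)
    simpa using h
  have hB' : Measurable (B.indicator fun _ => (1 : ℝ)) := measurable_const.indicator hB
  have hsmul : ∀ g : X → X, Integrable g μ →
      Integrable (fun y => B.indicator (fun _ => (1 : ℝ)) y • g y) μ := by
    intro g hg
    have e : (fun y => B.indicator (fun _ => (1 : ℝ)) y • g y) = B.indicator g := by
      funext y
      by_cases hy : y ∈ B <;> simp [hy]
    rw [e]
    exact hg.indicator hB
  have hm : Measurable fun q : X × X => B.indicator (fun _ => (1 : ℝ)) q.1 • q.2 :=
    (hB'.comp measurable_fst).smul measurable_snd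
  rw [integral_martCoupling hθ hm.stronglyMeasurable (hsmul _ (hμi.add hθi))
    (hsmul _ (hμi.sub hθi))]
  simp only [smul_add, smul_sub]
  rw [integral_add (hsmul _ hμi) (hsmul _ hθi), integral_sub (hsmul _ hμi) (hsmul _ hθi),
    ← smul_add, add_add_sub_cancel, ← two_smul ℝ, smul_smul]
  norm_num

lemma WpMart_muMart_le (hp : 1 ≤ p) (hμ : μ ∈ Pp (X := X) p) (hθ : Measurable θ)
    (hi : Integrable (fun y => ‖θ y‖ ^ p) μ) {t : ℝ} (ht : 0 ≤ t)
    (hle : ∫ y, ‖θ y‖ ^ p ∂μ ≤ t ^ p) : (WpMart p μ (muMart μ θ)).toReal ≤ t := by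
  have hp0 : 0 < p := by linarith
  have hm : Measurable fun q : X × X => ‖q.2 - q.1‖ ^ p :=
    (measurable_snd.sub measurable_fst).norm.pow_const p
  have e1 : (fun y => ‖(y, y + θ y).2 - (y, y + θ y).1‖ ^ p) = fun y => ‖θ y‖ ^ p := by simp
  have e2 : (fun y => ‖(y, y - θ y).2 - (y, y - θ y).1‖ ^ p) = fun y => ‖θ y‖ ^ p := by simp
  have hint : Integrable (fun q : X × X => ‖q.2 - q.1‖ ^ p) (martCoupling μ θ) :=
    integrable_martCoupling hθ hm.stronglyMeasurable (by rwa [e1]) (by rwa [e2])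
  have heq : ∫ q, ‖q.2 - q.1‖ ^ p ∂(martCoupling μ θ) = ∫ y, ‖θ y‖ ^ p ∂μ := by
    rw [integral_martCoupling hθ hm.stronglyMeasurable (by rwa [e1]) (by rwa [e2]), e1, e2,
      smul_eq_mul]
    ring
  refine ENNReal.toReal_le_of_le_ofReal ht ?_
  calc WpMart p μ (muMart μ θ)
      ≤ (∫⁻ q, (‖q.2 - q.1‖₊ : ℝ≥0∞) ^ p ∂(martCoupling μ θ)) ^ (1 / p) :=
        ENNReal.rpow_le_rpow (iInf₂_le _ (isMartCoupling_martCoupling hp hμ hθ hi)) (by positivity)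
    _ ≤ (ENNReal.ofReal (t ^ p)) ^ (1 / p) := by
        rw [← ofReal_integral_norm_rpow hp0.le hint, heq]
        gcongr
    _ = ENNReal.ofReal t := by
        rw [← ENNReal.ofReal_rpow_of_nonneg ht hp0.le, ← ENNReal.rpow_mul,
          mul_one_div_cancel hp0.ne', ENNReal.rpow_one]

lemma HessGrowth.integral_muMart_ge {C : ℝ} {f : X → ℝ} (hp : 2 < p) (hf : HessGrowth p C f)
    (hμ : μ ∈ Pp (X := X) p) {ε K : ℝ} {k : X → ℝ} (hK : 0 ≤ K) (hε : 0 ≤ ε)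
    (hk : Measurable k) (hk0 : ∀ y, 0 ≤ k y)
    (hkint : Integrable (fun y => k y ^ (p / (p - 2))) μ)
    (hkε : (∫ y, k y ^ (p / (p - 2)) ∂μ) ^ ((p - 2) / p) ≤ ε)
    (hrem : ∀ y u, |taylorRem f y u| ≤ k y * ‖u‖ ^ 2 + K * ‖u‖ ^ p)
    (hθ : Measurable θ) (hi : Integrable (fun y => ‖θ y‖ ^ p) μ)
    (hiH : Integrable (fun y => ⟪θ y, hess f y (θ y)⟫) μ) {t : ℝ} (ht : 0 ≤ t)
    (hle : ∫ y, ‖θ y‖ ^ p ∂μ ≤ t ^ p) :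
    ∫ x, f x ∂μ + 2⁻¹ * ∫ y, ⟪θ y, hess f y (θ y)⟫ ∂μ - ε * t ^ 2 - K * t ^ p ≤
      ∫ x, f x ∂(muMart μ θ) := by
  have hp0 : 0 < p := by linarith
  have hp1 : 1 ≤ p := by linarith
  have h := hf.abs_integral_sub_le hp hμ hk hk0 hkint hkε hrem (muMart_mem_Pp hp0.le hμ hθ hi)
    (isMartCoupling_martCoupling hp1 hμ hθ hi)
  have hm : Measurable fun q : X × X => ‖q.2 - q.1‖ ^ p :=
    (measurable_snd.sub measurable_fst).norm.pow_const p
  have e1 : (fun y => ‖(y, y + θ y).2 - (y, y + θ y).1‖ ^ p) = fun y => ‖θ y‖ ^ p := by simp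
  have e2 : (fun y => ‖(y, y - θ y).2 - (y, y - θ y).1‖ ^ p) = fun y => ‖θ y‖ ^ p := by simp
  have hcont := continuous_hess hf.1
  have hmH : Continuous fun q : X × X => ⟪q.2 - q.1, hess f q.1 (q.2 - q.1)⟫ := by fun_prop
  have e3 : (fun y => ⟪(y, y + θ y).2 - (y, y + θ y).1, hess f (y, y + θ y).1
      ((y, y + θ y).2 - (y, y + θ y).1)⟫) = fun y => ⟪θ y, hess f y (θ y)⟫ := by simp
  have e4 : (fun y => ⟪(y, y - θ y).2 - (y, y - θ y).1, hess f (y, y - θ y).1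
      ((y, y - θ y).2 - (y, y - θ y).1)⟫) = fun y => ⟪θ y, hess f y (θ y)⟫ := by simp
  rw [integral_martCoupling hθ hm.stronglyMeasurable (by rwa [e1]) (by rwa [e2]), e1, e2,
    integral_martCoupling hθ hmH.measurable.stronglyMeasurable (by rwa [e3]) (by rwa [e4]), e3, e4,
    ← add_smul, ← add_smul, show (2 : ℝ)⁻¹ + 2⁻¹ = 1 by norm_num, one_smul, one_smul] at h
  have h0 : 0 ≤ ∫ y, ‖θ y‖ ^ p ∂μ := integral_nonneg fun y => by positivity
  have h2 : (∫ y, ‖θ y‖ ^ p ∂μ) ^ (2 / p) ≤ t ^ 2 := by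
    calc _ ≤ (t ^ p) ^ (2 / p) := by gcongr
      _ = t ^ 2 := by rw [← Real.rpow_mul ht, mul_div_cancel₀ _ hp0.ne', Real.rpow_two]
  have h3 := mul_le_mul_of_nonneg_left h2 hε
  have h4 := mul_le_mul_of_nonneg_left hle hK
  have h5 := (_root_.abs_le.1 h).1
  linarith

end Perturbation

lemma HessGrowth.integral_sub_le {p C : ℝ} {f : X → ℝ} {μ ν : Measure X} (hp : 2 < p)
    (hf : HessGrowth p C f)
    (hμ : μ ∈ Pp (X := X) p) {ε K : ℝ} {k : X → ℝ} (hK : 0 ≤ K) (hε : 0 ≤ ε)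
    (hk : Measurable k) (hk0 : ∀ y, 0 ≤ k y)
    (hkint : Integrable (fun y => k y ^ (p / (p - 2))) μ)
    (hkε : (∫ y, k y ^ (p / (p - 2)) ∂μ) ^ ((p - 2) / p) ≤ ε)
    (hrem : ∀ y u, |taylorRem f y u| ≤ k y * ‖u‖ ^ 2 + K * ‖u‖ ^ p)
    (hν : ν ∈ Mp p μ) :
    ∫ x, f x ∂ν - ∫ x, f x ∂μ ≤
      (2⁻¹ * (∫ y, hessMax f y ^ (p / (p - 2)) ∂μ) ^ ((p - 2) / p) + ε) *
        (WpMart p μ ν).toReal ^ 2 + K * (WpMart p μ ν).toReal ^ p := by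
  have hp0 : 0 < p := by linarith
  have hp1 : 1 ≤ p := by linarith
  set M := (∫ y, hessMax f y ^ (p / (p - 2)) ∂μ) ^ ((p - 2) / p) with hM
  have hM0 : 0 ≤ M := Real.rpow_nonneg
    (integral_nonneg fun y => Real.rpow_nonneg (hessMax_nonneg f y) _) _
  obtain ⟨hνp, π₀, hπ₀⟩ := hν
  have hfin : WpMart p μ ν ≠ ⊤ := by
    have h1 := (integrable_norm_rpow_iff_lintegral (measurable_snd.sub measurable_fst) hp0.le).1
      (hπ₀.1.integrable_norm_sub_rpow hp1 hμ hνp)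
    refine ne_top_of_le_ne_top (ENNReal.rpow_ne_top_of_nonneg (by positivity) h1.ne)
      (ENNReal.rpow_le_rpow (iInf₂_le π₀ hπ₀) (by positivity : 0 ≤ 1 / p))
  set W := (WpMart p μ ν).toReal with hW
  have hW0 : 0 ≤ W := ENNReal.toReal_nonneg
  have key : ∀ η > 0, ∫ x, f x ∂ν - ∫ x, f x ∂μ ≤
      (2⁻¹ * M + ε) * (W + η) ^ 2 + K * (W + η) ^ p := by
    intro η hη
    have h0 : 0 ≤ W + η := by linarith
    have hlt : WpMart p μ ν < ENNReal.ofReal (W + η) := by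
      rw [← ENNReal.ofReal_toReal hfin]
      exact (ENNReal.ofReal_lt_ofReal_iff (by linarith)).2 (by linarith)
    have hlt' : (⨅ π ∈ {π : Measure (X × X) | IsMartCoupling μ ν π},
        ∫⁻ q, (‖q.2 - q.1‖₊ : ℝ≥0∞) ^ p ∂π) < ENNReal.ofReal ((W + η) ^ p) := by
      rw [← ENNReal.ofReal_rpow_of_nonneg h0 hp0.le]
      rw [WpMart, one_div] at hlt
      exact (ENNReal.rpow_inv_lt_iff hp0).1 hlt
    simp only [iInf_lt_iff] at hlt'
    obtain ⟨π, hπ, hlt'⟩ := hlt'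
    have hπ : IsMartCoupling μ ν π := hπ
    have hint := hπ.1.integrable_norm_sub_rpow hp1 hμ hνp
    have hw0 : 0 ≤ ∫ q, ‖q.2 - q.1‖ ^ p ∂π := integral_nonneg fun q => by positivity
    rw [← ofReal_integral_norm_rpow hp0.le hint] at hlt'
    have hw : ∫ q, ‖q.2 - q.1‖ ^ p ∂π ≤ (W + η) ^ p :=
      ((ENNReal.ofReal_lt_ofReal_iff_of_nonneg hw0).1 hlt').le
    have hw2 : (∫ q, ‖q.2 - q.1‖ ^ p ∂π) ^ (2 / p) ≤ (W + η) ^ 2 := by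
      calc _ ≤ ((W + η) ^ p) ^ (2 / p) := by gcongr
        _ = (W + η) ^ 2 := by rw [← Real.rpow_mul h0, mul_div_cancel₀ _ hp0.ne', Real.rpow_two]
    have h1 := (_root_.abs_le.1
      (hf.abs_integral_sub_le hp hμ hk hk0 hkint hkε hrem hνp hπ)).2
    obtain ⟨i2, h2⟩ := hπ.1.integrable_mul_sq hp (measurable_hessMax hf.1) (hessMax_nonneg f)
      (hf.integrable_hessMax_rpow hp (integrable_one_add_norm_rpow hp0.le hμ)) hint
    have h3 : ∫ q, ⟪q.2 - q.1, hess f q.1 (q.2 - q.1)⟫ ∂π ≤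
        ∫ q, hessMax f q.1 * ‖q.2 - q.1‖ ^ 2 ∂π :=
      integral_mono (hf.integrable_inner_hess hp hμ hνp hπ.1) i2
        fun q => inner_hess_le_hessMax_mul f _ _
    rw [← hM] at h2
    have h4 := mul_le_mul_of_nonneg_left hw2 (by positivity : 0 ≤ 2⁻¹ * M + ε)
    have h5 := mul_le_mul_of_nonneg_left hw hK
    linarith
  have hcont : Continuous fun η : ℝ => (2⁻¹ * M + ε) * (W + η) ^ 2 + K * (W + η) ^ p :=
    (by fun_prop : Continuous fun η : ℝ => (2⁻¹ * M + ε) * (W + η) ^ 2).add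
      (continuous_const.mul ((continuous_const.add continuous_id).rpow_const
        fun _ => Or.inr hp0.le))
  have hlim := (hcont.tendsto 0).mono_left (nhdsWithin_le_nhds (s := Ioi (0 : ℝ)))
  rw [add_zero] at hlim
  exact ge_of_tendsto hlim (eventually_mem_nhdsWithin.mono fun η hη => key η hη)

lemma EReal.coe_le_inv_mul_sub {h a c : ℝ} (hh : 0 < h) {I : EReal}
    (hI : ((c + h * a : ℝ) : EReal) ≤ I) : (a : EReal) ≤ ((h⁻¹ : ℝ) : EReal) * (I - (c : EReal)) := by
  induction I with
  | bot => exact absurd hI (EReal.bot_lt_coe _).not_ge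
  | top => simp [EReal.coe_mul_top_of_pos (inv_pos.2 hh)]
  | coe x =>
    rw [← EReal.coe_sub, ← EReal.coe_mul, EReal.coe_le_coe_iff, le_inv_mul_iff₀ hh]
    have := EReal.coe_le_coe_iff.1 hI
    linarith

lemma EReal.inv_mul_sub_le_coe {h b c : ℝ} (hh : 0 < h) {I : EReal}
    (hI : I ≤ ((c + h * b : ℝ) : EReal)) : ((h⁻¹ : ℝ) : EReal) * (I - (c : EReal)) ≤ (b : EReal) := by
  induction I with
  | bot => simp [EReal.bot_sub, EReal.coe_mul_bot_of_pos (inv_pos.2 hh)]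
  | top => exact absurd hI (EReal.coe_lt_top _).not_ge
  | coe x =>
    rw [← EReal.coe_sub, ← EReal.coe_mul, EReal.coe_le_coe_iff, inv_mul_le_iff₀ hh]
    have := EReal.coe_le_coe_iff.1 hI
    linarith

lemma coe_sub_coe_ennreal {x : ℝ} {y : ℝ≥0∞} (hy : y ≠ ⊤) :
    (x : EReal) - (y : EReal) = ((x - y.toReal : ℝ) : EReal) := by
  rw [EReal.coe_sub, EReal.coe_ennreal_toReal hy]

lemma eventually_mul_rpow_lt {s : ℝ} (hs : 0 < s) (A : ℝ) {δ : ℝ} (hδ : 0 < δ) :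
    ∀ᶠ h in 𝓝[>] (0 : ℝ), A * h ^ s < δ := by
  have h1 : Tendsto (fun h : ℝ => A * h ^ s) (𝓝 0) (𝓝 (A * 0 ^ s)) :=
    (tendsto_id.rpow_const (Or.inr hs.le)).const_mul A
  rw [Real.zero_rpow hs.ne', mul_zero] at h1
  exact (h1.mono_left nhdsWithin_le_nhds).eventually_lt_const hδ

lemma mul_rpow_half_eq {p h v : ℝ} (hh : 0 < h) (hv : 0 ≤ v) :
    (h * v) ^ (p / 2) = h * (h ^ (p / 2 - 1) * v ^ (p / 2)) := by
  rw [Real.mul_rpow hh.le hv, ← mul_assoc, mul_comm h, ← Real.rpow_add_one hh.ne', sub_add_cancel]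

lemma sqrt_rpow_eq {p x : ℝ} (hx : 0 ≤ x) : √x ^ p = x ^ (p / 2) := by
  rw [Real.sqrt_eq_rpow, ← Real.rpow_mul hx, one_div_mul_eq_div]

lemma sq_rpow_half_eq {p x : ℝ} (hx : 0 ≤ x) : (x ^ 2) ^ (p / 2) = x ^ p := by
  rw [← Real.rpow_two, ← Real.rpow_mul hx, mul_div_cancel₀ _ two_ne_zero]

section Limit

variable {p C : ℝ} {μ : Measure X} {φ : ℝ → ℝ≥0∞} {f : X → ℝ}

lemma HessGrowth.eventually_le_IMart (hp : 2 < p) (hf : HessGrowth p C f)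
    (hμ : μ ∈ Pp (X := X) p) (hmono : MonotoneOn φ (Ici (0 : ℝ))) {v a : ℝ} (hv : 0 ≤ v)
    (hφv : φ v ≠ ⊤)
    (ha : a < 2⁻¹ * (∫ y, hessMax f y ^ (p / (p - 2)) ∂μ) ^ ((p - 2) / p) * v - (φ v).toReal) :
    ∀ᶠ h in 𝓝[>] (0 : ℝ), ((∫ x, f x ∂μ + h * a : ℝ) : EReal) ≤ IMart μ φ p h f := by
  have hp0 : 0 < p := by linarith
  have hp1 : 1 ≤ p := by linarith
  have hμi := integrable_one_add_norm_rpow hp0.le hμ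
  set M := (∫ y, hessMax f y ^ (p / (p - 2)) ∂μ) ^ ((p - 2) / p) with hM
  have hM0 : 0 ≤ M := Real.rpow_nonneg
    (integral_nonneg fun y => Real.rpow_nonneg (hessMax_nonneg f y) _) _
  obtain ⟨δ, hδ, hδa⟩ : ∃ δ > 0, a + 2 * δ ≤ 2⁻¹ * M * v - (φ v).toReal :=
    ⟨(2⁻¹ * M * v - (φ v).toReal - a) / 2, by linarith, by linarith⟩
  have hS : 0 < 2⁻¹ * M * v + v + 1 := by positivity
  obtain ⟨ε, hε, hε1, hεδ⟩ : ∃ ε > 0, ε ≤ 1 ∧ ε * (2⁻¹ * M * v + v + 1) ≤ δ :=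
    ⟨min 1 (δ / (2⁻¹ * M * v + v + 1)), lt_min one_pos (by positivity), min_le_left _ _,
      (le_div_iff₀ hS).1 (min_le_right _ _)⟩
  obtain ⟨K, k, hK, hk, hk0, hkint, hkε, hrem⟩ := hf.exists_taylor_bound hp hμi hε
  filter_upwards [self_mem_nhdsWithin,
    eventually_mul_rpow_lt (by linarith : 0 < p / 2 - 1) (K * v ^ (p / 2)) hδ] with h hh hhδ
  have hh : 0 < h := hh
  have hhv : 0 ≤ h * v := by positivity
  obtain ⟨θ, hθ, hi, hle, hiH, hge⟩ :=
    hf.exists_perturbation hp hμi hε hε1 (Real.sqrt_nonneg (h * v))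
  have hint := hf.integral_muMart_ge hp hμ hK hε.le hk hk0 hkint hkε hrem hθ hi hiH
    (Real.sqrt_nonneg _) hle
  have hW := WpMart_muMart_le hp1 hμ hθ hi (Real.sqrt_nonneg _) hle
  rw [← hM] at hge
  rw [Real.sq_sqrt hhv] at hge hint
  rw [sqrt_rpow_eq hhv, mul_rpow_half_eq hh hv] at hint
  have hW2 : (WpMart p μ (muMart μ θ)).toReal ^ 2 ≤ h * v := by
    rw [← Real.sq_sqrt hhv]
    gcongr
  have hpen : phih φ h ((WpMart p μ (muMart μ θ)).toReal ^ 2) ≤ ENNReal.ofReal h * φ v := by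
    refine mul_le_mul_right (hmono (mem_Ici.2 (by positivity)) hv ?_) _
    rwa [div_le_iff₀' hh]
  have hcalc : ∫ x, f x ∂μ + h * a ≤
      ∫ x, f x ∂(muMart μ θ) - (ENNReal.ofReal h * φ v).toReal := by
    rw [ENNReal.toReal_mul, ENNReal.toReal_ofReal hh.le]
    have h1 := mul_le_mul_of_nonneg_left hδa hh.le
    have h2 := mul_le_mul_of_nonneg_left hεδ hh.le
    have h3 := mul_le_mul_of_nonneg_left hhδ.le hh.le
    have h4 := mul_pos hh hε
    linarith
  calc ((∫ x, f x ∂μ + h * a : ℝ) : EReal)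
      ≤ ((∫ x, f x ∂(muMart μ θ) - (ENNReal.ofReal h * φ v).toReal : ℝ) : EReal) :=
        EReal.coe_le_coe_iff.2 hcalc
    _ = ((∫ x, f x ∂(muMart μ θ) : ℝ) : EReal) - ((ENNReal.ofReal h * φ v : ℝ≥0∞) : EReal) :=
        (coe_sub_coe_ennreal (ENNReal.mul_ne_top ENNReal.ofReal_ne_top hφv)).symm
    _ ≤ ((∫ x, f x ∂(muMart μ θ) : ℝ) : EReal) -
        ((phih φ h ((WpMart p μ (muMart μ θ)).toReal ^ 2) : ℝ≥0∞) : EReal) :=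
        EReal.sub_le_sub le_rfl (EReal.coe_ennreal_le_coe_ennreal_iff.2 hpen)
    _ ≤ IMart μ φ p h f :=
        le_iSup₂_of_le (muMart μ θ) ⟨muMart_mem_Pp hp0.le hμ hθ hi, _,
          isMartCoupling_martCoupling hp1 hμ hθ hi⟩ le_rfl

lemma exists_mul_rpow_le_toReal {s : ℝ}
    (hgrowth : 0 < liminf (fun v : ℝ => φ v / ENNReal.ofReal (v ^ s)) atTop) :
    ∃ c > 0, ∀ᶠ v in atTop, φ v ≠ ⊤ → c * v ^ s ≤ (φ v).toReal := by
  obtain ⟨c, hc0, hc⟩ := ENNReal.lt_iff_exists_nnreal_btwn.1 hgrowth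
  refine ⟨c, by exact_mod_cast hc0, ?_⟩
  filter_upwards [eventually_lt_of_lt_liminf hc, eventually_ge_atTop 0] with v hv hv0 hφ
  have h1 := ENNReal.toReal_mono hφ (ENNReal.mul_le_of_le_div hv.le)
  rwa [ENNReal.toReal_mul, ENNReal.coe_toReal,
    ENNReal.toReal_ofReal (Real.rpow_nonneg hv0 _)] at h1

lemma HessGrowth.eventually_IMart_le (hp : 2 < p) (hf : HessGrowth p C f)
    (hμ : μ ∈ Pp (X := X) p)
    (hgrowth : 0 < liminf (fun v : ℝ => φ v / ENNReal.ofReal (v ^ (p / 2))) atTop)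
    {L b : ℝ} (hL : 0 ≤ L) (hLb : L < b)
    (hφL : ∀ v, 0 ≤ v → φ v ≠ ⊤ →
      2⁻¹ * (∫ y, hessMax f y ^ (p / (p - 2)) ∂μ) ^ ((p - 2) / p) * v - (φ v).toReal ≤ L) :
    ∀ᶠ h in 𝓝[>] (0 : ℝ), IMart μ φ p h f ≤ ((∫ x, f x ∂μ + h * b : ℝ) : EReal) := by
  have hp0 : 0 < p := by linarith
  have hμi := integrable_one_add_norm_rpow hp0.le hμ
  set M := (∫ y, hessMax f y ^ (p / (p - 2)) ∂μ) ^ ((p - 2) / p) with hM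
  have hM0 : 0 ≤ M := Real.rpow_nonneg
    (integral_nonneg fun y => Real.rpow_nonneg (hessMax_nonneg f y) _) _
  obtain ⟨c, hc, hφc⟩ := exists_mul_rpow_le_toReal hgrowth
  have hsup : ∀ᶠ v : ℝ in atTop, 2 * (2⁻¹ * M + 1) / c ≤ v ^ (p / 2 - 1) :=
    (tendsto_rpow_atTop (by linarith)).eventually_ge_atTop _
  obtain ⟨V, hV⟩ := ((hφc.and hsup).and (eventually_gt_atTop 0)).exists_forall_of_atTop
  have hV0 : 0 < V := (hV V le_rfl).2
  obtain ⟨δ, hδ, hδb⟩ : ∃ δ > 0, L + 2 * δ ≤ b := ⟨(b - L) / 2, by linarith, by linarith⟩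
  obtain ⟨ε, hε, hε1, hεδ⟩ : ∃ ε > 0, ε ≤ 1 ∧ ε * V ≤ δ :=
    ⟨min 1 (δ / V), lt_min one_pos (by positivity), min_le_left _ _,
      (le_div_iff₀ hV0).1 (min_le_right _ _)⟩
  obtain ⟨K, k, hK, hk, hk0, hkint, hkε, hrem⟩ := hf.exists_taylor_bound hp hμi hε
  filter_upwards [self_mem_nhdsWithin,
    eventually_mul_rpow_lt (by linarith : 0 < p / 2 - 1) (K * V ^ (p / 2)) hδ,
    eventually_mul_rpow_lt (by linarith : 0 < p / 2 - 1) K (half_pos hc)] with h hh hhδ hhc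
  have hh : 0 < h := hh
  refine iSup₂_le fun ν hν => ?_
  have hint := hf.integral_sub_le hp hμ hK hε.le hk hk0 hkint hkε hrem hν
  rw [← hM] at hint
  set W := (WpMart p μ ν).toReal with hW
  have hW0 : 0 ≤ W := ENNReal.toReal_nonneg
  set v := W ^ 2 / h with hv
  have hv0 : 0 ≤ v := by positivity
  have hWv : W ^ 2 = h * v := by rw [hv, mul_div_cancel₀ _ hh.ne']
  rw [← sq_rpow_half_eq hW0, hWv, mul_rpow_half_eq hh hv0] at hint
  rw [phih, ← hv]
  by_cases hφ : φ v = ⊤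
  · rw [hφ, ENNReal.mul_top (by simpa using hh)]
    simp
  rw [coe_sub_coe_ennreal (ENNReal.mul_ne_top ENNReal.ofReal_ne_top hφ), EReal.coe_le_coe_iff,
    ENNReal.toReal_mul, ENNReal.toReal_ofReal hh.le]
  suffices hs : (2⁻¹ * M + ε) * v + K * (h ^ (p / 2 - 1) * v ^ (p / 2)) - (φ v).toReal ≤ b by
    have := mul_le_mul_of_nonneg_left hs hh.le
    linarith
  rcases le_total v V with hvV | hvV
  · have h1 : K * (h ^ (p / 2 - 1) * v ^ (p / 2)) ≤ K * V ^ (p / 2) * h ^ (p / 2 - 1) := by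
      rw [mul_comm (h ^ _), ← mul_assoc]
      gcongr
    have h2 : ε * v ≤ ε * V := by gcongr
    have h3 := hφL v hv0 hφ
    linarith
  · obtain ⟨⟨hv1, hv2⟩, hvpos⟩ := hV v hvV
    have h1 : (2⁻¹ * M + 1) * v ≤ c / 2 * v ^ (p / 2) := by
      have h4 : v ^ (p / 2) = v ^ (p / 2 - 1) * v := by
        rw [← Real.rpow_add_one hvpos.ne', sub_add_cancel]
      rw [div_le_iff₀ hc] at hv2
      rw [h4, ← mul_assoc]
      gcongr
      linarith
    have h2 : K * (h ^ (p / 2 - 1) * v ^ (p / 2)) ≤ c / 2 * v ^ (p / 2) := by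
      rw [← mul_assoc]
      gcongr
    have h3 : ε * v ≤ 1 * v := by gcongr
    have h5 := hv1 hφ
    linarith

end Limit

theorem stmt6 (p : ℝ) (hp : 2 < p)
    (μ : Measure X) (hμ : μ ∈ Pp (X := X) p)
    (φ : ℝ → ℝ≥0∞) (hmono : MonotoneOn φ (Ici (0 : ℝ))) (hzero : φ 0 = 0)
    (hgrowth : 0 < liminf (fun v : ℝ => φ v / ENNReal.ofReal (v ^ (p / 2))) atTop)
    (f : X → ℝ) (hf : MemC2p p f) :
    Tendsto (fun h : ℝ =>
        ((h⁻¹ : ℝ) : EReal) * (IMart μ φ p h f - ((∫ x, f x ∂μ : ℝ) : EReal)))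
      (𝓝[>] (0 : ℝ))
      (𝓝 (phiStar φ
        (2⁻¹ * (∫ y, hessMax f y ^ (p / (p - 2)) ∂μ) ^ ((p - 2) / p)))) := by
  obtain ⟨hfc, C, hC, hfC⟩ := hf
  have hf : HessGrowth p C f := ⟨hfc, hC, hfC⟩
  refine tendsto_order.2 ⟨fun a ha => ?_, fun b hb => ?_⟩
  · obtain ⟨v, hv⟩ := lt_iSup_iff.1 ha
    obtain ⟨hv0, hv⟩ := lt_iSup_iff.1 hv
    have hφv : φ v ≠ ⊤ := by
      intro hφ
      simp [hφ] at hv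
    rw [coe_sub_coe_ennreal hφv] at hv
    obtain ⟨a', haa', ha'⟩ := EReal.lt_iff_exists_real_btwn.1 hv
    filter_upwards [self_mem_nhdsWithin,
      hf.eventually_le_IMart hp hμ hmono hv0 hφv (EReal.coe_lt_coe_iff.1 ha')] with h hh hI
    exact haa'.trans_le (EReal.coe_le_inv_mul_sub hh hI)
  · obtain ⟨b', hLb', hb'⟩ := EReal.lt_iff_exists_real_btwn.1 hb
    obtain ⟨L, hL, hLb⟩ := EReal.lt_iff_exists_real_btwn.1 hLb'
    have hle : ∀ v, 0 ≤ v → φ v ≠ ⊤ →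
        2⁻¹ * (∫ y, hessMax f y ^ (p / (p - 2)) ∂μ) ^ ((p - 2) / p) * v - (φ v).toReal ≤ L := by
      intro v hv hφ
      have h1 := (le_iSup₂ (f := fun (v : ℝ) (_ : v ∈ Ici (0 : ℝ)) =>
        ((2⁻¹ * (∫ y, hessMax f y ^ (p / (p - 2)) ∂μ) ^ ((p - 2) / p) * v : ℝ) : EReal) -
          ((φ v : ℝ≥0∞) : EReal)) v hv).trans hL.le
      rw [coe_sub_coe_ennreal hφ] at h1
      exact EReal.coe_le_coe_iff.1 h1
    have hL0 : 0 ≤ L := by simpa [hzero] using hle 0 le_rfl (by simp [hzero])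
    filter_upwards [self_mem_nhdsWithin,
      hf.eventually_IMart_le hp hμ hgrowth hL0 (EReal.coe_lt_coe_iff.1 hLb) hle] with h hh hI
    exact (EReal.inv_mul_sub_le_coe hh hI).trans_lt hb'
end
end

section
/- Let n ∈ ℕ, x₁,…,xₙ ∈ X, α₁,…,αₙ ∈ (0,∞) with Σᵢ αᵢ = 1, and μ = Σᵢ αᵢ δ_{xᵢ}. Let D ⊆ Xⁿ be dense in the product space Xⁿ with 0 ∈ D, and define I_D(h)f := sup_{(θ₁,…,θₙ) ∈ D} ( Σᵢ αᵢ f(xᵢ+θᵢ) − φ_h( (Σᵢ αᵢ ‖θᵢ‖^p)^{1/p} ) ). Then lim_{h↓0} (I(h)f − I_D(h)f)/h = 0 for every f ∈ Lip_p that admits a measurable direction of steepest ascent. -/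
open MeasureTheory Filter Set
open scoped Topology ENNReal NNReal RealInnerProductSpace

noncomputable section

variable {X : Type*} [NormedAddCommGroup X] [InnerProductSpace ℝ X]
  [SecondCountableTopology X] [CompleteSpace X] [MeasurableSpace X] [BorelSpace X]

/-- The finite-dimensional parametric functional `I_D(h) f` for a reference measure
given by a convex combination of Dirac measures. -/
def IDirac {n : ℕ} (x : Fin n → X) (α : Fin n → ℝ) (φ : ℝ → ℝ≥0∞) (p : ℝ)
    (D : Set (Fin n → X)) (h : ℝ) (f : X → ℝ) : EReal :=
  ⨆ d ∈ D, ((∑ i, α i * f (x i + d i) : ℝ) : EReal)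
    - ((phih φ h ((∑ i, α i * ‖d i‖ ^ p) ^ (1 / p)) : ℝ≥0∞) : EReal)

set_option linter.unusedSectionVars false

theorem exists_growth_of_liminf_pos {p : ℝ} {φ : ℝ → ℝ≥0∞}
    (hgrowth : 0 < liminf (fun v : ℝ => φ v / ENNReal.ofReal (v ^ p)) atTop) :
    ∃ c : ℝ, 0 < c ∧ ∃ V : ℝ, ∀ v, V ≤ v → φ v ≠ ⊤ → c * v ^ p ≤ (φ v).toReal := by
  obtain ⟨c, hc0, hc⟩ := exists_between hgrowth
  have hctop : c ≠ ⊤ := ne_top_of_lt hc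
  obtain ⟨V, hV⟩ := eventually_atTop.1 (eventually_lt_of_lt_liminf hc)
  refine ⟨c.toReal, ENNReal.toReal_pos hc0.ne' hctop, V, fun v hv hφ => ?_⟩
  have h1 : c * ENNReal.ofReal (v ^ p) ≤ φ v := ENNReal.mul_le_of_le_div (hV v hv).le
  have h2 := ENNReal.toReal_mono hφ h1
  rw [ENNReal.toReal_mul] at h2
  refine le_trans ?_ h2
  gcongr
  exact ENNReal.toReal_ofReal' ▸ le_max_left _ _

/-- A penalty of growth order at least `p` has a finite conjugate `K` at `Λ`, and `K`
stays an approximate upper bound under perturbations that are linear or of order `p`. -/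
theorem exists_conjugate {p : ℝ} (hp : 1 < p) {φ : ℝ → ℝ≥0∞} (hzero : φ 0 = 0)
    (hgrowth : 0 < liminf (fun v : ℝ => φ v / ENNReal.ofReal (v ^ p)) atTop)
    {Λ : ℝ} (hΛ : 0 ≤ Λ) :
    ∃ K : ℝ, (∀ δ > 0, ∃ w, 0 ≤ w ∧ φ w ≠ ⊤ ∧ K - δ < Λ * w - (φ w).toReal) ∧
      ∀ δ > 0, ∃ ε > 0, ∀ C : ℝ, 0 ≤ C → ∀ᶠ h in 𝓝[>] (0 : ℝ), ∀ w, 0 ≤ w → φ w ≠ ⊤ →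
        (Λ + ε) * w + C * h ^ (p - 1) * w ^ p - (φ w).toReal ≤ K + δ := by
  obtain ⟨c, hc, V, hV⟩ := exists_growth_of_liminf_pos hgrowth
  have hp1 : 0 < p - 1 := by linarith
  obtain ⟨R, hRV, hR1, hRc⟩ : ∃ R, V ≤ R ∧ 1 ≤ R ∧ (Λ + 1) / (c / 2) ≤ R ^ (p - 1) :=
    ((eventually_ge_atTop V).and ((eventually_ge_atTop 1).and
      ((tendsto_rpow_atTop hp1).eventually_ge_atTop _))).exists
  have hlarge : ∀ w, R ≤ w → (Λ + 1) * w ≤ c / 2 * w ^ p := by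
    intro w hw
    have hw0 : 0 < w := by linarith
    have h1 : Λ + 1 ≤ c / 2 * w ^ (p - 1) := by
      rw [div_le_iff₀ (by positivity), mul_comm] at hRc
      exact hRc.trans (by gcongr)
    calc (Λ + 1) * w ≤ c / 2 * w ^ (p - 1) * w := by gcongr
      _ = c / 2 * w ^ p := by
        rw [mul_assoc, ← Real.rpow_add_one hw0.ne']
        ring_nf
  set A : Set ℝ := {y | ∃ w, 0 ≤ w ∧ φ w ≠ ⊤ ∧ y = Λ * w - (φ w).toReal} with hA
  have hA0 : (0 : ℝ) ∈ A := ⟨0, le_rfl, by simp [hzero], by simp [hzero]⟩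
  have hAbdd : BddAbove A := by
    refine ⟨Λ * R, ?_⟩
    rintro y ⟨w, hw0, hw, rfl⟩
    have hφ0 : 0 ≤ (φ w).toReal := ENNReal.toReal_nonneg
    rcases le_total R w with h | h
    · have h1 := hlarge w h
      have h2 := hV w (hRV.trans h) hw
      have h3 : 0 ≤ c * w ^ p := by positivity
      have h4 : 0 ≤ Λ * R := by positivity
      nlinarith
    · have : Λ * w ≤ Λ * R := by gcongr
      linarith
  refine ⟨sSup A, fun δ hδ => ?_, fun δ hδ => ?_⟩
  · obtain ⟨y, ⟨w, hw0, hw, rfl⟩, hy⟩ := exists_lt_of_lt_csSup ⟨0, hA0⟩ (sub_lt_self (sSup A) hδ)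
    exact ⟨w, hw0, hw, hy⟩
  have hK0 : 0 ≤ sSup A := le_csSup hAbdd hA0
  refine ⟨min 1 (δ / (2 * R)), by positivity, fun C hC => ?_⟩
  have hlim : Tendsto (fun h : ℝ => C * h ^ (p - 1)) (𝓝[>] 0) (𝓝 0) := by
    have h1 : Tendsto (fun h : ℝ => h ^ (p - 1)) (𝓝 0) (𝓝 0) := by
      simpa [Real.zero_rpow hp1.ne'] using
        (Real.continuousAt_rpow_const 0 (p - 1) (Or.inr hp1.le)).tendsto
    simpa using (h1.mono_left nhdsWithin_le_nhds).const_mul C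
  have hRp : 0 < R ^ p := by positivity
  filter_upwards [hlim.eventually_le_const (u := c / 2) (by positivity),
    hlim.eventually_le_const (u := δ / 2 / R ^ p) (by positivity), self_mem_nhdsWithin]
    with h h1 h2 h3 w hw0 hw
  have h3 : 0 < h := h3
  rcases le_total R w with hwR | hwR
  · have h4 := hlarge w hwR
    have h5 := hV w (hRV.trans hwR) hw
    have h6 : C * h ^ (p - 1) * w ^ p ≤ c / 2 * w ^ p := by gcongr
    have h7 : (Λ + min 1 (δ / (2 * R))) * w ≤ (Λ + 1) * w := by
      gcongr
      exact min_le_left _ _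
    linarith
  · have h4 : Λ * w - (φ w).toReal ≤ sSup A := le_csSup hAbdd ⟨w, hw0, hw, rfl⟩
    have h5 : min 1 (δ / (2 * R)) * w ≤ δ / (2 * R) * R := by
      gcongr
      exact min_le_right _ _
    have h6 : δ / (2 * R) * R = δ / 2 := by field_simp
    have h7 : C * h ^ (p - 1) * w ^ p ≤ δ / 2 / R ^ p * R ^ p := by gcongr
    rw [div_mul_cancel₀ _ hRp.ne'] at h7
    linarith

theorem MemLipP.continuous {p : ℝ} (hp : 1 < p) {f : X → ℝ} (hf : MemLipP p f) :
    Continuous f := by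
  obtain ⟨L, hL, hf⟩ := hf
  rw [continuous_iff_continuousAt]
  intro x
  have hcont : Continuous fun z : X => L * (1 + max ‖z‖ ‖x‖) ^ (p - 1) * ‖z - x‖ := by
    refine (continuous_const.mul (Continuous.rpow_const (by fun_prop) fun _ => ?_)).mul
      (by fun_prop)
    right; linarith
  refine tendsto_iff_norm_sub_tendsto_zero.2 (squeeze_zero (fun _ => norm_nonneg _)
    (fun z => hf z x) ?_)
  simpa using hcont.tendsto x

theorem slope_le_of_bound {p L : ℝ} (hp : 1 < p) (hL : 0 ≤ L) {f : X → ℝ}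
    (hf : ∀ x₁ x₂ : X, |f x₁ - f x₂| ≤ L * (1 + max ‖x₁‖ ‖x₂‖) ^ (p - 1) * ‖x₁ - x₂‖)
    (x u : X) (hu : ‖u‖ = 0 ∨ ‖u‖ = 1) {h : ℝ} (h0 : 0 < h) (h1 : h < 1) :
    (f (x + h • u) - f x) / h ≤ L * (2 + ‖x‖) ^ (p - 1) := by
  have hu1 : ‖u‖ ≤ 1 := by rcases hu with h | h <;> simp [h]
  have hhu : ‖h • u‖ ≤ h := by
    rw [norm_smul, Real.norm_of_nonneg h0.le]
    exact mul_le_of_le_one_right h0.le hu1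
  rw [div_le_iff₀ h0]
  refine (le_abs_self _).trans ((hf _ _).trans ?_)
  rw [add_sub_cancel_left]
  have hmax : 1 + max ‖x + h • u‖ ‖x‖ ≤ 2 + ‖x‖ := by
    have : max ‖x + h • u‖ ‖x‖ ≤ 1 + ‖x‖ :=
      max_le ((norm_add_le _ _).trans (by linarith)) (by linarith)
    linarith
  have hp1 : 0 ≤ p - 1 := by linarith
  gcongr

theorem eventually_bddAbove_slopes {p : ℝ} (hp : 1 < p) {f : X → ℝ} (hf : MemLipP p f) (x : X) :
    ∃ M : ℝ, ∀ᶠ h in 𝓝[>] (0 : ℝ), ∀ u : X, (‖u‖ = 0 ∨ ‖u‖ = 1) →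
      (f (x + h • u) - f x) / h ≤ M := by
  obtain ⟨L, hL, hf⟩ := hf
  refine ⟨L * (2 + ‖x‖) ^ (p - 1), ?_⟩
  filter_upwards [Ioo_mem_nhdsGT (zero_lt_one' ℝ)] with h hh u hu
  exact slope_le_of_bound hp hL hf x u hu hh.1 hh.2

theorem isBoundedUnder_le_sSup_slopes {p : ℝ} (hp : 1 < p) {f : X → ℝ} (hf : MemLipP p f)
    (x : X) :
    IsBoundedUnder (· ≤ ·) (𝓝[>] (0 : ℝ)) fun h : ℝ =>
      sSup ((fun u : X => (f (x + h • u) - f x) / h) '' {u : X | ‖u‖ = 0 ∨ ‖u‖ = 1}) := by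
  obtain ⟨M, hM⟩ := eventually_bddAbove_slopes hp hf x
  refine isBoundedUnder_of_eventually_le (a := M) (hM.mono fun h hh => ?_)
  exact csSup_le ⟨_, 0, by simp, rfl⟩ (by rintro _ ⟨u, hu, rfl⟩; exact hh u hu)

theorem locLip_nonneg {p : ℝ} (hp : 1 < p) {f : X → ℝ} (hf : MemLipP p f) (x : X) :
    0 ≤ locLip f x := by
  obtain ⟨M, hM⟩ := eventually_bddAbove_slopes hp hf x
  refine le_limsup_of_frequently_le (Eventually.frequently (hM.mono fun h hh => ?_))
    (isBoundedUnder_le_sSup_slopes hp hf x)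
  exact le_csSup ⟨M, by rintro _ ⟨u, hu, rfl⟩; exact hh u hu⟩ ⟨0, by simp, by simp⟩

theorem exists_local_bound_of_locLip_lt {p : ℝ} (hp : 1 < p) {f : X → ℝ} (hf : MemLipP p f)
    (x : X) {a : ℝ} (ha : locLip f x < a) :
    ∃ r > 0, ∀ z, ‖z - x‖ < r → f z - f x ≤ a * ‖z - x‖ := by
  obtain ⟨M, hM⟩ := eventually_bddAbove_slopes hp hf x
  have h1 := eventually_lt_of_limsup_lt ha (isBoundedUnder_le_sSup_slopes hp hf x)
  obtain ⟨r, hr, hr'⟩ := mem_nhdsGT_iff_exists_Ioo_subset.1 (hM.and h1)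
  refine ⟨r, hr, fun z hz => ?_⟩
  rcases eq_or_ne z x with rfl | hzx
  · simp
  have hpos : 0 < ‖z - x‖ := norm_pos_iff.2 (sub_ne_zero.2 hzx)
  obtain ⟨h2, h3⟩ := hr' ⟨hpos, hz⟩
  have hu : ‖(‖z - x‖⁻¹ • (z - x))‖ = 0 ∨ ‖(‖z - x‖⁻¹ • (z - x))‖ = 1 := by
    right
    rw [norm_smul, norm_inv, norm_norm, inv_mul_cancel₀ hpos.ne']
  have hbdd : BddAbove ((fun u : X => (f (x + ‖z - x‖ • u) - f x) / ‖z - x‖) ''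
      {u : X | ‖u‖ = 0 ∨ ‖u‖ = 1}) := ⟨M, by rintro _ ⟨u, hu', rfl⟩; exact h2 u hu'⟩
  have h4 := (le_csSup hbdd (mem_image_of_mem _ hu)).trans h3.le
  rwa [smul_smul, mul_inv_cancel₀ hpos.ne', one_smul, add_sub_cancel, div_le_iff₀ hpos] at h4

/-- The increments of `f` at `x` grow at most linearly with a rate just above the local
Lipschitz constant, up to an error of order `p`. -/
theorem exists_increment_bound {p : ℝ} (hp : 1 < p) {f : X → ℝ} (hf : MemLipP p f)
    (x : X) {ε : ℝ} (hε : 0 < ε) :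
    ∃ C, 0 ≤ C ∧ ∀ z, f z - f x ≤ (locLip f x + ε) * ‖z - x‖ + C * ‖z - x‖ ^ p := by
  obtain ⟨r, hr, hloc⟩ := exists_local_bound_of_locLip_lt hp hf x (lt_add_of_pos_right _ hε)
  have hlip := locLip_nonneg hp hf x
  obtain ⟨L, hL, hf⟩ := hf
  have hp1 : 0 ≤ p - 1 := by linarith
  refine ⟨L * ((1 + ‖x‖) / r + 1) ^ (p - 1), by positivity, fun z => ?_⟩
  rcases lt_or_ge ‖z - x‖ r with hz | hz
  · have : 0 ≤ L * ((1 + ‖x‖) / r + 1) ^ (p - 1) * ‖z - x‖ ^ p := by positivity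
    linarith [hloc z hz]
  have ht : 0 < ‖z - x‖ := hr.trans_le hz
  have hmax : 1 + max ‖z‖ ‖x‖ ≤ ((1 + ‖x‖) / r + 1) * ‖z - x‖ := by
    have h1 : max ‖z‖ ‖x‖ ≤ ‖x‖ + ‖z - x‖ :=
      max_le (by simpa using norm_add_le x (z - x)) (by linarith)
    have h2 : (1 + ‖x‖) / r * r ≤ (1 + ‖x‖) / r * ‖z - x‖ := by gcongr
    rw [div_mul_cancel₀ _ hr.ne'] at h2
    linarith
  have h3 : L * (1 + max ‖z‖ ‖x‖) ^ (p - 1) * ‖z - x‖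
      ≤ L * (((1 + ‖x‖) / r + 1) * ‖z - x‖) ^ (p - 1) * ‖z - x‖ := by gcongr
  have h4 : ‖z - x‖ ^ p = ‖z - x‖ ^ (p - 1) * ‖z - x‖ := by
    rw [← Real.rpow_add_one ht.ne', sub_add_cancel]
  rw [Real.mul_rpow (by positivity) ht.le] at h3
  have h5 : 0 ≤ (locLip f x + ε) * ‖z - x‖ := by positivity
  rw [h4]
  calc f z - f x ≤ _ := (le_abs_self _).trans (hf z x)
    _ ≤ _ := h3
    _ = L * ((1 + ‖x‖) / r + 1) ^ (p - 1) * (‖z - x‖ ^ (p - 1) * ‖z - x‖) := by ring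
    _ ≤ _ := by linarith

theorem integrable_and_integral_sum_dirac {n : ℕ} (x : Fin n → X) {α : Fin n → ℝ}
    (hα : ∀ i, 0 ≤ α i) (g : X → ℝ) :
    Integrable g (∑ i, ENNReal.ofReal (α i) • Measure.dirac (x i)) ∧
      ∫ y, g y ∂(∑ i, ENNReal.ofReal (α i) • Measure.dirac (x i)) = ∑ i, α i * g (x i) := by
  have hint : ∀ i, Integrable g (ENNReal.ofReal (α i) • Measure.dirac (x i)) := fun i =>
    (integrable_dirac (by simp)).smul_measure ENNReal.ofReal_ne_top
  refine ⟨integrable_finsetSum_measure.2 fun i _ => hint i, ?_⟩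
  rw [integral_finsetSum_measure fun i _ => hint i]
  simp [integral_smul_measure, ENNReal.toReal_ofReal (hα _)]

theorem isProbabilityMeasure_sum_dirac {n : ℕ} (x : Fin n → X) {α : Fin n → ℝ}
    (hα : ∀ i, 0 ≤ α i) (hsum : ∑ i, α i = 1) :
    IsProbabilityMeasure (∑ i, ENNReal.ofReal (α i) • Measure.dirac (x i)) := by
  constructor
  simp [← ENNReal.ofReal_sum_of_nonneg fun i _ => hα i, hsum]

theorem sum_dirac_mem_Pp {n : ℕ} (x : Fin n → X) {α : Fin n → ℝ}
    (hα : ∀ i, 0 ≤ α i) (hsum : ∑ i, α i = 1) {p : ℝ} (hp : 0 ≤ p) :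
    (∑ i, ENNReal.ofReal (α i) • Measure.dirac (x i)) ∈ Pp (X := X) p := by
  refine ⟨isProbabilityMeasure_sum_dirac x hα hsum, ?_⟩
  rw [lintegral_finsetSum_measure]
  refine ENNReal.sum_lt_top.2 fun i _ => ?_
  simp [lintegral_smul_measure, ENNReal.mul_lt_top_iff, ENNReal.rpow_lt_top_of_nonneg hp]

theorem MemLipP.integrable {p : ℝ} (hp : 1 < p) {f : X → ℝ} (hf : MemLipP p f) {ν : Measure X}
    (hν : ν ∈ Pp (X := X) p) : Integrable f ν := by
  obtain ⟨hprob, hmom⟩ := hν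
  have hcont := hf.continuous hp
  obtain ⟨L, hL, hf⟩ := hf
  have hnorm : Integrable (fun z : X => ‖z‖ ^ p) ν := by
    refine ⟨((continuous_norm.rpow_const fun _ => Or.inr (by linarith)).aestronglyMeasurable), ?_⟩
    refine lt_of_eq_of_lt (lintegral_congr fun z => ?_) hmom
    rw [Real.enorm_rpow_of_nonneg (norm_nonneg _) (by linarith), enorm_norm]
    rfl
  refine Integrable.mono' ((integrable_const (|f 0| + L * 2 ^ p)).add
    (hnorm.const_mul (L * 2 ^ p))) hcont.aestronglyMeasurable (Eventually.of_forall fun z => ?_)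
  have h1 := hf z 0
  simp only [norm_zero, sub_zero, norm_nonneg, sup_of_le_left] at h1
  have h2 : (1 + ‖z‖) ^ (p - 1) * ‖z‖ ≤ (1 + ‖z‖) ^ p := by
    have h0 : (0 : ℝ) < 1 + ‖z‖ := by positivity
    calc (1 + ‖z‖) ^ (p - 1) * ‖z‖ ≤ (1 + ‖z‖) ^ (p - 1) * (1 + ‖z‖) := by gcongr; linarith
      _ = (1 + ‖z‖) ^ p := by rw [← Real.rpow_add_one h0.ne', sub_add_cancel]
  have h3 : (1 + ‖z‖) ^ p ≤ 2 ^ p * (1 + ‖z‖ ^ p) := by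
    have hp0 : 0 ≤ p := by linarith
    rcases le_total ‖z‖ 1 with h | h
    · have : (1 + ‖z‖) ^ p ≤ 2 ^ p := by gcongr; linarith
      have h4 : (0 : ℝ) ≤ 2 ^ p * ‖z‖ ^ p := by positivity
      linarith
    · have : (1 + ‖z‖) ^ p ≤ (2 * ‖z‖) ^ p := by gcongr; linarith
      rw [Real.mul_rpow (by norm_num) (norm_nonneg _)] at this
      have h4 : (0 : ℝ) ≤ 2 ^ p := by positivity
      linarith
  have h4 : |f z| ≤ |f 0| + |f z - f 0| := by
    simpa using abs_add_le (f 0) (f z - f 0)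
  have h5 : L * ((1 + ‖z‖) ^ (p - 1) * ‖z‖) ≤ L * (2 ^ p * (1 + ‖z‖ ^ p)) :=
    mul_le_mul_of_nonneg_left (h2.trans h3) hL
  simp only [Pi.add_apply, Real.norm_eq_abs]
  calc |f z| ≤ |f 0| + L * ((1 + ‖z‖) ^ (p - 1) * ‖z‖) := by linarith
    _ ≤ |f 0| + L * (2 ^ p * (1 + ‖z‖ ^ p)) := by linarith
    _ = _ := by ring

theorem integrable_and_integral_cost {p : ℝ} (hp : 0 < p) {π : Measure (X × X)}
    (hc : ∫⁻ q, (‖q.1 - q.2‖₊ : ℝ≥0∞) ^ p ∂π ≠ ⊤) :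
    Integrable (fun q : X × X => ‖q.1 - q.2‖ ^ p) π ∧
      ∫ q, ‖q.1 - q.2‖ ^ p ∂π = (∫⁻ q, (‖q.1 - q.2‖₊ : ℝ≥0∞) ^ p ∂π).toReal := by
  have hmeas : AEStronglyMeasurable (fun q : X × X => ‖q.1 - q.2‖ ^ p) π :=
    (Continuous.rpow_const (by fun_prop) fun _ => Or.inr hp.le).aestronglyMeasurable
  have henorm : ∀ q : X × X, ‖‖q.1 - q.2‖ ^ p‖ₑ = (‖q.1 - q.2‖₊ : ℝ≥0∞) ^ p := fun q => by
    rw [Real.enorm_rpow_of_nonneg (norm_nonneg _) hp.le, enorm_norm]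
    rfl
  refine ⟨⟨hmeas, ?_⟩, ?_⟩
  · rw [HasFiniteIntegral, lintegral_congr henorm]
    exact hc.lt_top
  · rw [integral_eq_lintegral_of_nonneg_ae (Eventually.of_forall fun q => by positivity) hmeas]
    congr 1
    refine lintegral_congr fun q => ?_
    rw [← henorm, Real.enorm_of_nonneg (by positivity)]

theorem memLp_of_integrable_rpow {Ω : Type*} [MeasurableSpace Ω] {m : Measure Ω} {g : Ω → ℝ}
    {q : ℝ} (hq : 0 < q) (hg0 : ∀ y, 0 ≤ g y) (hg : AEStronglyMeasurable g m)
    (hint : Integrable (fun y => g y ^ q) m) : MemLp g (ENNReal.ofReal q) m := by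
  refine (integrable_norm_rpow_iff hg (by simpa using hq) (by simp)).1 ?_
  simpa [ENNReal.toReal_ofReal hq.le, abs_of_nonneg (hg0 _)] using hint

/-- Hölder's inequality for a coupling whose first marginal is finitely supported. -/
theorem integral_mul_norm_sub_le {p q : ℝ} (hpq : p.HolderConjugate q) {n : ℕ} (x : Fin n → X)
    {α : Fin n → ℝ} (hα : ∀ i, 0 ≤ α i) {π : Measure (X × X)}
    (hπ : π.map Prod.fst = ∑ i, ENNReal.ofReal (α i) • Measure.dirac (x i))
    (hc : ∫⁻ q, (‖q.1 - q.2‖₊ : ℝ≥0∞) ^ p ∂π ≠ ⊤) {g : X → ℝ} (hg : ∀ y, 0 ≤ g y) :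
    Integrable (fun q : X × X => g q.1 * ‖q.1 - q.2‖) π ∧
      ∫ q, g q.1 * ‖q.1 - q.2‖ ∂π ≤ (∑ i, α i * g (x i) ^ q) ^ (1 / q) *
        (∫⁻ q, (‖q.1 - q.2‖₊ : ℝ≥0∞) ^ p ∂π).toReal ^ (1 / p) := by
  have hdiscr := integrable_and_integral_sum_dirac x hα
  rw [← hπ] at hdiscr
  have hgL : MemLp (fun q : X × X => g q.1) (ENNReal.ofReal q) π :=
    (memLp_of_integrable_rpow hpq.symm.pos hg (hdiscr g).1.aestronglyMeasurable
      (hdiscr fun y => g y ^ q).1).comp_measurePreserving ⟨measurable_fst, rfl⟩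
  obtain ⟨hint, hval⟩ := integrable_and_integral_cost hpq.pos hc
  have hTL : MemLp (fun q : X × X => ‖q.1 - q.2‖) (ENNReal.ofReal p) π :=
    memLp_of_integrable_rpow hpq.pos (fun _ => norm_nonneg _)
      (Continuous.aestronglyMeasurable (by fun_prop)) hint
  have hpq' : (ENNReal.ofReal q).HolderConjugate (ENNReal.ofReal p) := hpq.symm.ennrealOfReal
  refine ⟨hgL.integrable_mul hTL, ?_⟩
  refine (integral_mul_le_Lp_mul_Lq_of_nonneg hpq.symm (Eventually.of_forall fun q => hg q.1)
    (Eventually.of_forall fun q => norm_nonneg _) hgL hTL).trans_eq ?_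
  rw [hval, ← (hdiscr fun y => g y ^ q).2, integral_map measurable_fst.aemeasurable
    (hdiscr fun y => g y ^ q).1.aestronglyMeasurable]

/-- The increment of the integral of `f` along a coupling of finite cost. -/
theorem integral_sub_le_of_coupling {p q : ℝ} (hp : 1 < p) (hpq : p.HolderConjugate q) {n : ℕ}
    (x : Fin n → X) {α : Fin n → ℝ} (hα : ∀ i, 0 ≤ α i) (hsum : ∑ i, α i = 1)
    {f : X → ℝ} (hf : MemLipP p f) {ε C : ℝ} (hε : 0 < ε)
    (hC : ∀ i z, f z - f (x i) ≤ (locLip f (x i) + ε) * ‖z - x i‖ + C * ‖z - x i‖ ^ p)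
    {ν : Measure X} (hν : ν ∈ Pp (X := X) p) {π : Measure (X × X)}
    (hπ : IsCoupling (∑ i, ENNReal.ofReal (α i) • Measure.dirac (x i)) ν π)
    (hc : ∫⁻ q, (‖q.1 - q.2‖₊ : ℝ≥0∞) ^ p ∂π ≠ ⊤) :
    ∫ z, f z ∂ν - ∑ i, α i * f (x i) ≤
      ((∑ i, α i * locLip f (x i) ^ q) ^ (1 / q) + ε) *
          (∫⁻ q, (‖q.1 - q.2‖₊ : ℝ≥0∞) ^ p ∂π).toReal ^ (1 / p)
        + C * (∫⁻ q, (‖q.1 - q.2‖₊ : ℝ≥0∞) ^ p ∂π).toReal := by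
  obtain ⟨hπ1, hπ2⟩ := hπ
  obtain ⟨hi1, hb1⟩ := integral_mul_norm_sub_le hpq x hα hπ1 hc (locLip_nonneg hp hf)
  obtain ⟨hi2, hb2⟩ := integral_mul_norm_sub_le hpq x hα hπ1 hc (g := fun _ => ε) fun _ => hε.le
  obtain ⟨hi3, hb3⟩ := integrable_and_integral_cost hpq.pos hc
  have hfν := hf.integrable hp hν
  obtain ⟨hfμ, hfμ'⟩ := integrable_and_integral_sum_dirac x hα f
  rw [← hπ1] at hfμ hfμ'
  rw [← hπ2] at hfν ⊢
  rw [← hfμ', integral_map measurable_fst.aemeasurable hfμ.aestronglyMeasurable,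
    integral_map measurable_snd.aemeasurable hfν.aestronglyMeasurable]
  have hf1 : Integrable (fun q : X × X => f q.1) π := hfμ.comp_measurable measurable_fst
  have hf2 : Integrable (fun q : X × X => f q.2) π := hfν.comp_measurable measurable_snd
  have hsupp : ∀ᵐ q ∂π, q.1 ∈ range x := by
    have h1 : ∀ᵐ y ∂(π.map Prod.fst), y ∈ range x := by
      rw [hπ1, ae_iff, Measure.finsetSum_apply]
      refine Finset.sum_eq_zero fun i _ => ?_
      have hr : MeasurableSet {y : X | y ∉ range x} := (finite_range x).measurableSet.compl
      rw [Measure.smul_apply, Measure.dirac_apply' _ hr]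
      simp
    exact ae_of_ae_map measurable_fst.aemeasurable h1
  have hle : ∫ q, (f q.2 - f q.1) ∂π ≤
      ∫ q, (locLip f q.1 * ‖q.1 - q.2‖ + ε * ‖q.1 - q.2‖ + C * ‖q.1 - q.2‖ ^ p) ∂π := by
    refine integral_mono_ae (hf2.sub hf1) ((hi1.add hi2).add (hi3.const_mul C)) ?_
    filter_upwards [hsupp] with q hq
    obtain ⟨i, hi⟩ := hq
    have := hC i q.2
    rw [hi, norm_sub_rev] at this
    linarith
  have hi12 : Integrable (fun q : X × X => locLip f q.1 * ‖q.1 - q.2‖ + ε * ‖q.1 - q.2‖) π :=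
    hi1.add hi2
  rw [integral_sub hf2 hf1, integral_add hi12 (hi3.const_mul C), integral_add hi1 hi2,
    integral_const_mul C, hb3] at hle
  rw [← Finset.sum_mul, hsum, one_mul, ← Real.rpow_mul hε.le, mul_one_div_cancel
    hpq.symm.ne_zero, Real.rpow_one] at hb2
  linarith

theorem exists_coupling_cost_ne_top {p : ℝ} (hp : 1 ≤ p) {μ ν : Measure X}
    (hμ : μ ∈ Pp (X := X) p) (hν : ν ∈ Pp (X := X) p) :
    ∃ π : Measure (X × X), IsCoupling μ ν π ∧
      ∫⁻ q, (‖q.1 - q.2‖₊ : ℝ≥0∞) ^ p ∂π ≠ ⊤ := by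
  obtain ⟨hμ1, hμ2⟩ := hμ
  obtain ⟨hν1, hν2⟩ := hν
  refine ⟨μ.prod ν, ⟨by simp, by simp⟩, ne_top_of_le_ne_top ?_ (lintegral_mono fun q =>
    (ENNReal.rpow_le_rpow (by exact_mod_cast nnnorm_sub_le q.1 q.2) (by linarith)).trans
      (ENNReal.rpow_add_le_mul_rpow_add_rpow (‖q.1‖₊ : ℝ≥0∞) (‖q.2‖₊ : ℝ≥0∞) hp))⟩
  have hmeas : Measurable fun z : X => (‖z‖₊ : ℝ≥0∞) ^ p := by fun_prop
  have h1 : ∫⁻ q, (‖q.1‖₊ : ℝ≥0∞) ^ p ∂(μ.prod ν) = ∫⁻ y, (‖y‖₊ : ℝ≥0∞) ^ p ∂μ :=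
    measurePreserving_fst.lintegral_comp hmeas
  have h2 : ∫⁻ q, (‖q.2‖₊ : ℝ≥0∞) ^ p ∂(μ.prod ν) = ∫⁻ y, (‖y‖₊ : ℝ≥0∞) ^ p ∂ν :=
    measurePreserving_snd.lintegral_comp hmeas
  rw [lintegral_const_mul' _ _ (by finiteness), lintegral_add_left (by fun_prop), h1, h2]
  finiteness

theorem integral_sub_le_of_Wp {p q : ℝ} (hp : 1 < p) (hpq : p.HolderConjugate q) {n : ℕ}
    (x : Fin n → X) {α : Fin n → ℝ} (hα : ∀ i, 0 ≤ α i) (hsum : ∑ i, α i = 1)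
    {f : X → ℝ} (hf : MemLipP p f) {ε C : ℝ} (hε : 0 < ε) (hC0 : 0 ≤ C)
    (hC : ∀ i z, f z - f (x i) ≤ (locLip f (x i) + ε) * ‖z - x i‖ + C * ‖z - x i‖ ^ p)
    {ν : Measure X} (hν : ν ∈ Pp (X := X) p) :
    ∫ z, f z ∂ν - ∑ i, α i * f (x i) ≤
      ((∑ i, α i * locLip f (x i) ^ q) ^ (1 / q) + ε) *
          (Wp p (∑ i, ENNReal.ofReal (α i) • Measure.dirac (x i)) ν).toReal
        + C * (Wp p (∑ i, ENNReal.ofReal (α i) • Measure.dirac (x i)) ν).toReal ^ p := by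
  set μ := ∑ i, ENNReal.ofReal (α i) • Measure.dirac (x i) with hμ
  set J : ℝ≥0∞ := ⨅ π ∈ {π : Measure (X × X) | IsCoupling μ ν π},
    ∫⁻ q, (‖q.1 - q.2‖₊ : ℝ≥0∞) ^ p ∂π with hJ
  have hp0 : 0 < p := by linarith
  have hJtop : J ≠ ⊤ := by
    obtain ⟨π, hπ, hc⟩ := exists_coupling_cost_ne_top hp.le
      (sum_dirac_mem_Pp x hα hsum hp0.le) hν
    exact ne_top_of_le_ne_top hc (iInf₂_le π hπ)
  have hW : (Wp p μ ν).toReal = J.toReal ^ (1 / p) := by rw [Wp, ENNReal.toReal_rpow]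
  have hWp : (Wp p μ ν).toReal ^ p = J.toReal := by
    rw [hW, ← Real.rpow_mul ENNReal.toReal_nonneg, one_div_mul_cancel hp0.ne', Real.rpow_one]
  rw [hWp, hW]
  set Λ := (∑ i, α i * locLip f (x i) ^ q) ^ (1 / q) with hΛ
  have hΛ0 : 0 ≤ Λ := Real.rpow_nonneg (Finset.sum_nonneg fun i _ =>
    mul_nonneg (hα i) (Real.rpow_nonneg (locLip_nonneg hp hf _) _)) _
  have hcont : Continuous fun t : ℝ => (Λ + ε) * t ^ (1 / p) + C * t :=
    (continuous_const.mul (Real.continuous_rpow_const (by positivity))).add (by fun_prop)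
  refine ge_of_tendsto ((hcont.tendsto J.toReal).mono_left
    (nhdsWithin_le_nhds (s := Ioi J.toReal))) ?_
  filter_upwards [self_mem_nhdsWithin] with t ht
  have ht0 : 0 < t := ENNReal.toReal_nonneg.trans_lt ht
  have hJt : J < ENNReal.ofReal t := (ENNReal.lt_ofReal_iff_toReal_lt hJtop).2 ht
  obtain ⟨π, hlt'⟩ := iInf_lt_iff.1 hJt
  obtain ⟨hπ, hlt⟩ := iInf_lt_iff.1 hlt'
  have hctop := ne_top_of_lt hlt
  refine (integral_sub_le_of_coupling hp hpq x hα hsum hf hε hC hν hπ hctop).trans ?_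
  have hle : (∫⁻ q, (‖q.1 - q.2‖₊ : ℝ≥0∞) ^ p ∂π).toReal ≤ t :=
    ((ENNReal.lt_ofReal_iff_toReal_lt hctop).1 hlt).le
  gcongr

theorem coe_phih {φ : ℝ → ℝ≥0∞} {h v : ℝ} (hh : 0 < h) (hφ : φ (v / h) ≠ ⊤) :
    ((phih φ h v : ℝ≥0∞) : EReal) = ((h * (φ (v / h)).toReal : ℝ) : EReal) := by
  rw [phih, ← EReal.coe_toReal (x := ((ENNReal.ofReal h * φ (v / h) : ℝ≥0∞) : EReal))
    (EReal.coe_ennreal_eq_top_iff.not.2 (ENNReal.mul_ne_top ENNReal.ofReal_ne_top hφ))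
    (EReal.coe_ennreal_ne_bot _),
    EReal.toReal_coe_ennreal, ENNReal.toReal_mul, ENNReal.toReal_ofReal hh.le]

theorem sub_phih_le {φ : ℝ → ℝ≥0∞} {h v a M : ℝ} (hh : 0 < h)
    (hM : φ (v / h) ≠ ⊤ → a - h * (φ (v / h)).toReal ≤ M) :
    (a : EReal) - ((phih φ h v : ℝ≥0∞) : EReal) ≤ (M : EReal) := by
  by_cases hφ : φ (v / h) = ⊤
  · rw [phih, hφ, ENNReal.mul_top (by simpa using hh)]
    simp
  · rw [coe_phih hh hφ]
    exact_mod_cast hM hφ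

theorem phih_mono {φ : ℝ → ℝ≥0∞} (hmono : MonotoneOn φ (Ici (0 : ℝ))) {h v w : ℝ} (hh : 0 < h)
    (hv : 0 ≤ v) (hvw : v ≤ w) : phih φ h v ≤ phih φ h w := by
  have hw := hv.trans hvw
  refine mul_le_mul_right (hmono (by rw [mem_Ici]; positivity) (by rw [mem_Ici]; positivity) ?_) _
  gcongr

/-- Shifting the atoms of a finitely supported measure moves it at most by the `p`-norm of the
shift. -/
theorem Wp_toReal_shift_le {p : ℝ} (hp : 0 < p) {n : ℕ} (x d : Fin n → X) {α : Fin n → ℝ}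
    (hα : ∀ i, 0 ≤ α i) :
    (Wp p (∑ i, ENNReal.ofReal (α i) • Measure.dirac (x i))
      (∑ i, ENNReal.ofReal (α i) • Measure.dirac (x i + d i))).toReal ≤
        (∑ i, α i * ‖d i‖ ^ p) ^ (1 / p) := by
  set π : Measure (X × X) := ∑ i, ENNReal.ofReal (α i) • Measure.dirac (x i, x i + d i) with hπ
  have hmap : ∀ g : X × X → X, Measurable g →
      π.map g = ∑ i, ENNReal.ofReal (α i) • Measure.dirac (g (x i, x i + d i)) := by
    intro g hg
    ext s hs
    rw [Measure.map_apply hg hs, hπ, Measure.finsetSum_apply, Measure.finsetSum_apply]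
    refine Finset.sum_congr rfl fun i _ => ?_
    rw [Measure.smul_apply, Measure.smul_apply, Measure.dirac_apply' _ (hg hs),
      Measure.dirac_apply' _ hs]
    rfl
  have hcost : ∫⁻ q, (‖q.1 - q.2‖₊ : ℝ≥0∞) ^ p ∂π =
      ENNReal.ofReal (∑ i, α i * ‖d i‖ ^ p) := by
    rw [hπ, lintegral_finsetSum_measure, ENNReal.ofReal_sum_of_nonneg fun i _ =>
      mul_nonneg (hα i) (by positivity)]
    refine Finset.sum_congr rfl fun i _ => ?_
    rw [lintegral_smul_measure, lintegral_dirac, ENNReal.ofReal_mul (hα i),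
      ← ENNReal.ofReal_rpow_of_nonneg (norm_nonneg _) hp.le, ofReal_norm]
    simp [enorm_eq_nnnorm]
  have hsum0 : 0 ≤ ∑ i, α i * ‖d i‖ ^ p :=
    Finset.sum_nonneg fun i _ => mul_nonneg (hα i) (by positivity)
  refine ENNReal.toReal_le_of_le_ofReal (by positivity) ?_
  rw [← ENNReal.ofReal_rpow_of_nonneg hsum0 (by positivity), ← hcost, Wp]
  exact ENNReal.rpow_le_rpow (iInf₂_le π ⟨hmap _ measurable_fst, hmap _ measurable_snd⟩)
    (by positivity)

theorem IDirac_le_Ifun {p : ℝ} (hp : 0 < p) {φ : ℝ → ℝ≥0∞}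
    (hmono : MonotoneOn φ (Ici (0 : ℝ))) {n : ℕ} (x : Fin n → X) {α : Fin n → ℝ}
    (hα : ∀ i, 0 ≤ α i) (hsum : ∑ i, α i = 1) (D : Set (Fin n → X)) {h : ℝ} (hh : 0 < h)
    (f : X → ℝ) :
    IDirac x α φ p D h f ≤
      Ifun (∑ i, ENNReal.ofReal (α i) • Measure.dirac (x i)) φ p h f := by
  refine iSup₂_le fun d _ => ?_
  refine le_trans ?_ (le_iSup₂ (f := fun (ν : Measure X) (_ : ν ∈ Pp (X := X) p) =>
    ((∫ x, f x ∂ν : ℝ) : EReal) - ((phih φ h (Wp p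
      (∑ i, ENNReal.ofReal (α i) • Measure.dirac (x i)) ν).toReal : ℝ≥0∞) : EReal))
    (∑ i, ENNReal.ofReal (α i) • Measure.dirac (x i + d i))
    (sum_dirac_mem_Pp (fun i => x i + d i) hα hsum hp.le))
  rw [(integrable_and_integral_sum_dirac (fun i => x i + d i) hα f).2]
  refine EReal.sub_le_sub le_rfl ?_
  exact_mod_cast phih_mono hmono hh ENNReal.toReal_nonneg (Wp_toReal_shift_le hp x d hα)

theorem eventually_Ifun_le {p q : ℝ} (hp : 1 < p) (hpq : p.HolderConjugate q)
    {φ : ℝ → ℝ≥0∞} {n : ℕ} (x : Fin n → X) {α : Fin n → ℝ}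
    (hα : ∀ i, 0 ≤ α i) (hsum : ∑ i, α i = 1) {f : X → ℝ} (hf : MemLipP p f) {B ε : ℝ}
    (hε : 0 < ε)
    (hB : ∀ C : ℝ, 0 ≤ C → ∀ᶠ h in 𝓝[>] (0 : ℝ), ∀ w, 0 ≤ w → φ w ≠ ⊤ →
      ((∑ i, α i * locLip f (x i) ^ q) ^ (1 / q) + ε) * w + C * h ^ (p - 1) * w ^ p
        - (φ w).toReal ≤ B) :
    ∀ᶠ h in 𝓝[>] (0 : ℝ), Ifun (∑ i, ENNReal.ofReal (α i) • Measure.dirac (x i)) φ p h f ≤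
      ((∑ i, α i * f (x i) + h * B : ℝ) : EReal) := by
  choose C hC0 hC using fun i => exists_increment_bound hp hf (x i) hε
  have hC0' : 0 ≤ ∑ i, C i := Finset.sum_nonneg fun i _ => hC0 i
  have hCsum : ∀ i z, f z - f (x i) ≤
      (locLip f (x i) + ε) * ‖z - x i‖ + (∑ i, C i) * ‖z - x i‖ ^ p := fun i z => by
    refine (hC i z).trans ?_
    gcongr
    exact Finset.single_le_sum (fun i _ => hC0 i) (Finset.mem_univ i)
  filter_upwards [hB _ hC0', self_mem_nhdsWithin] with h hh h0
  have h0 : 0 < h := h0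
  refine iSup₂_le fun ν hν => sub_phih_le h0 fun hφ => ?_
  have h1 := integral_sub_le_of_Wp hp hpq x hα hsum hf hε hC0' hCsum hν
  set W := (Wp p (∑ i, ENNReal.ofReal (α i) • Measure.dirac (x i)) ν).toReal
  have hW : 0 ≤ W := ENNReal.toReal_nonneg
  have h2 := mul_le_mul_of_nonneg_left (hh (W / h) (by positivity) hφ) h0.le
  have h3 : h * (h ^ (p - 1) * (W / h) ^ p) = W ^ p := by
    rw [Real.div_rpow hW h0.le, Real.rpow_sub_one h0.ne']
    have : 0 < h ^ p := by positivity
    field_simp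
  have h4 : h * (W / h) = W := by field_simp
  linear_combination h1 + h2 - (∑ i, C i) * h3 -
    ((∑ i, α i * locLip f (x i) ^ q) ^ (1 / q) + ε) * h4

/-- The weighted `ℓ^q` norm is attained in the dual unit ball. -/
theorem exists_dual_weights {p q : ℝ} (hpq : p.HolderConjugate q) {n : ℕ} {α l : Fin n → ℝ}
    (hα : ∀ i, 0 ≤ α i) (hl : ∀ i, 0 ≤ l i) :
    ∃ s : Fin n → ℝ, (∀ i, 0 ≤ s i) ∧ ∑ i, α i * s i ^ p ≤ 1 ∧
      ∑ i, α i * (l i * s i) = (∑ i, α i * l i ^ q) ^ (1 / q) := by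
  have hS0 : 0 ≤ ∑ i, α i * l i ^ q :=
    Finset.sum_nonneg fun i _ => mul_nonneg (hα i) (Real.rpow_nonneg (hl i) _)
  set S := ∑ i, α i * l i ^ q with hS
  rcases hS0.eq_or_lt with h0 | hpos
  · refine ⟨fun _ => 0, fun _ => le_rfl, ?_, ?_⟩
    · simp [Real.zero_rpow hpq.ne_zero]
    · rw [← h0, Real.zero_rpow (one_div_ne_zero hpq.symm.ne_zero)]
      simp
  have hq1 : 0 < q - 1 := hpq.symm.sub_one_pos
  refine ⟨fun i => l i ^ (q - 1) * S ^ (-(1 / p)), fun i => by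
    have := hl i; positivity, le_of_eq ?_, ?_⟩
  · have h1 : ∀ i, α i * (l i ^ (q - 1) * S ^ (-(1 / p))) ^ p = α i * l i ^ q * S⁻¹ := by
      intro i
      rw [Real.mul_rpow (Real.rpow_nonneg (hl i) _) (by positivity), ← Real.rpow_mul (hl i),
        ← Real.rpow_mul hpos.le, hpq.symm.sub_one_mul_conj, neg_mul,
        one_div_mul_cancel hpq.ne_zero, Real.rpow_neg_one, mul_assoc]
    simp_rw [h1]
    rw [← Finset.sum_mul, ← hS, mul_inv_cancel₀ hpos.ne']
  · have h1 : ∀ i, α i * (l i * (l i ^ (q - 1) * S ^ (-(1 / p)))) =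
        α i * l i ^ q * S ^ (-(1 / p)) := by
      intro i
      rcases (hl i).eq_or_lt with h | h
      · simp [← h, Real.zero_rpow hpq.symm.ne_zero]
      · rw [Real.rpow_sub_one h.ne']
        field_simp
    simp_rw [h1]
    rw [← Finset.sum_mul, ← hS]
    nth_rewrite 1 [← Real.rpow_one S]
    rw [← Real.rpow_add hpos]
    congr 1
    have := hpq.inv_add_inv_eq_one
    rw [one_div, one_div]
    linarith

theorem SteepestAscent.tendsto_mul {f : X → ℝ} {v : X → X} (hv : SteepestAscent f v) (x : X)
    {τ : ℝ} (hτ : 0 ≤ τ) :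
    Tendsto (fun h : ℝ => (f (x + (h * τ) • v x) - f x) / h) (𝓝[>] 0)
      (𝓝 (locLip f x * τ)) := by
  rcases hτ.eq_or_lt with rfl | hτ
  · simp
  have h1 : Tendsto (fun h : ℝ => h * τ) (𝓝[>] 0) (𝓝[>] 0) := by
    refine tendsto_nhdsWithin_iff.2 ⟨?_, ?_⟩
    · have : Tendsto (fun h : ℝ => h * τ) (𝓝 0) (𝓝 (0 * τ)) := tendsto_id.mul_const τ
      rw [zero_mul] at this
      exact this.mono_left nhdsWithin_le_nhds
    · filter_upwards [self_mem_nhdsWithin] with h hh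
      exact mul_pos hh hτ
  refine (((hv.2 x).2.comp h1).mul_const τ).congr fun h => ?_
  simp only [Function.comp_apply]
  rw [div_mul_eq_mul_div, mul_div_mul_right _ _ hτ.ne']

theorem eventually_exists_shift {p q : ℝ} (hp : 1 < p) (hpq : p.HolderConjugate q)
    {n : ℕ} (x : Fin n → X) {α : Fin n → ℝ} (hα : ∀ i, 0 ≤ α i)
    {D : Set (Fin n → X)} (hD : Dense D) (hzeroD : (fun _ : Fin n => (0 : X)) ∈ D)
    {f : X → ℝ} (hf : MemLipP p f) {v : X → X} (hv : SteepestAscent f v)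
    {w δ : ℝ} (hw : 0 ≤ w) (hδ : 0 < δ) :
    ∀ᶠ h in 𝓝[>] (0 : ℝ), ∃ d ∈ D, (∑ i, α i * ‖d i‖ ^ p) ^ (1 / p) ≤ h * w ∧
      ∑ i, α i * f (x i) + h * ((∑ i, α i * locLip f (x i) ^ q) ^ (1 / q) * w - δ) ≤
        ∑ i, α i * f (x i + d i) := by
  have hp0 : 0 < p := by linarith
  rcases hw.eq_or_lt with rfl | hw
  · filter_upwards [self_mem_nhdsWithin] with h hh
    have hh : 0 < h := hh
    refine ⟨_, hzeroD, ?_, ?_⟩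
    · simp [Real.zero_rpow hp0.ne', Real.zero_rpow (inv_ne_zero hp0.ne')]
    · simp only [mul_zero, zero_sub, add_zero]
      nlinarith
  obtain ⟨s, hs0, hs1, hs⟩ := exists_dual_weights hpq hα fun i => locLip_nonneg hp hf (x i)
  set Λ := (∑ i, α i * locLip f (x i) ^ q) ^ (1 / q) with hΛ
  have hΛ0 : 0 ≤ Λ := hs ▸ Finset.sum_nonneg fun i _ =>
    mul_nonneg (hα i) (mul_nonneg (locLip_nonneg hp hf _) (hs0 i))
  obtain ⟨r, hr0, hrw, hr⟩ : ∃ r, 0 ≤ r ∧ r < w ∧ Λ * w - δ < Λ * r := by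
    have hcont : Tendsto (fun r => Λ * r) (𝓝[<] w) (𝓝 (Λ * w)) :=
      ((continuous_const.mul continuous_id).tendsto w).mono_left nhdsWithin_le_nhds
    have hmem : ∀ᶠ r in 𝓝[<] w, r ∈ Ioo 0 w := Ioo_mem_nhdsLT hw
    obtain ⟨r, h1, h2⟩ := (hmem.and (hcont.eventually_const_lt (sub_lt_self _ hδ))).exists
    exact ⟨r, h1.1.le, h1.2, h2⟩
  have hlim : Tendsto (fun h : ℝ =>
      ∑ i, α i * ((f (x i + (h * (r * s i)) • v (x i)) - f (x i)) / h)) (𝓝[>] 0) (𝓝 (Λ * r)) := by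
    have h1 : Λ * r = ∑ i, α i * (locLip f (x i) * (r * s i)) := by
      rw [← hs, Finset.sum_mul]
      exact Finset.sum_congr rfl fun i _ => by ring
    rw [h1]
    exact tendsto_finsetSum _ fun i _ =>
      (hv.tendsto_mul (x i) (mul_nonneg hr0 (hs0 i))).const_mul (α i)
  filter_upwards [hlim.eventually_const_lt hr, self_mem_nhdsWithin] with h hh h0
  have h0 : 0 < h := h0
  have hfc := hf.continuous hp
  have hN : Continuous fun d : Fin n → X => (∑ i, α i * ‖d i‖ ^ p) ^ (1 / p) :=
    Continuous.rpow_const (continuous_finsetSum _ fun i _ =>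
      continuous_const.mul (Continuous.rpow_const (by fun_prop) fun _ => Or.inr hp0.le))
      fun _ => Or.inr (by positivity)
  have hF : Continuous fun d : Fin n → X => ∑ i, α i * f (x i + d i) := by fun_prop
  set d₀ : Fin n → X := fun i => (h * (r * s i)) • v (x i) with hd₀
  have hd₀N : (∑ i, α i * ‖d₀ i‖ ^ p) ^ (1 / p) < h * w := by
    have h1 : ∑ i, α i * ‖d₀ i‖ ^ p ≤ (h * r) ^ p := by
      calc ∑ i, α i * ‖d₀ i‖ ^ p ≤ ∑ i, (h * r) ^ p * (α i * s i ^ p) := by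
            refine Finset.sum_le_sum fun i _ => ?_
            have hsi := hs0 i
            have h2 : ‖d₀ i‖ ≤ h * r * s i := by
              have hv1 : ‖v (x i)‖ ≤ 1 := by rcases (hv.2 (x i)).1 with h | h <;> simp [h]
              rw [hd₀, norm_smul, Real.norm_of_nonneg (by positivity), ← mul_assoc]
              have h3 : 0 ≤ h * r * s i := by positivity
              exact mul_le_of_le_one_right h3 hv1
            have h3 : ‖d₀ i‖ ^ p ≤ (h * r * s i) ^ p := by gcongr
            rw [Real.mul_rpow (by positivity) hsi] at h3
            have := mul_le_mul_of_nonneg_left h3 (hα i)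
            linarith
        _ = (h * r) ^ p * ∑ i, α i * s i ^ p := by rw [Finset.mul_sum]
        _ ≤ (h * r) ^ p := mul_le_of_le_one_right (by positivity) hs1
    have h0sum : 0 ≤ ∑ i, α i * ‖d₀ i‖ ^ p :=
      Finset.sum_nonneg fun i _ => mul_nonneg (hα i) (by positivity)
    calc (∑ i, α i * ‖d₀ i‖ ^ p) ^ (1 / p) ≤ ((h * r) ^ p) ^ (1 / p) := by gcongr
      _ = h * r := by
        rw [← Real.rpow_mul (by positivity), mul_one_div_cancel hp0.ne', Real.rpow_one]
      _ < h * w := by gcongr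
  have hd₀F : ∑ i, α i * f (x i) + h * (Λ * w - δ) < ∑ i, α i * f (x i + d₀ i) := by
    have h1 := mul_lt_mul_of_pos_left hh h0
    have h2 : h * ∑ i, α i * ((f (x i + (h * (r * s i)) • v (x i)) - f (x i)) / h) =
        ∑ i, α i * f (x i + d₀ i) - ∑ i, α i * f (x i) := by
      rw [Finset.mul_sum, ← Finset.sum_sub_distrib]
      refine Finset.sum_congr rfl fun i _ => ?_
      rw [mul_left_comm, mul_div_cancel₀ _ h0.ne', mul_sub]
    linarith
  obtain ⟨d, ⟨h1, h2⟩, hdD⟩ := hD.inter_open_nonempty _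
    ((isOpen_lt hN continuous_const).inter (isOpen_lt continuous_const hF)) ⟨d₀, hd₀N, hd₀F⟩
  exact ⟨d, hdD, le_of_lt h1, le_of_lt h2⟩

theorem eventually_le_IDirac {p q : ℝ} (hp : 1 < p) (hpq : p.HolderConjugate q)
    {φ : ℝ → ℝ≥0∞} (hmono : MonotoneOn φ (Ici (0 : ℝ)))
    {n : ℕ} (x : Fin n → X) {α : Fin n → ℝ} (hα : ∀ i, 0 ≤ α i)
    {D : Set (Fin n → X)} (hD : Dense D) (hzeroD : (fun _ : Fin n => (0 : X)) ∈ D)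
    {f : X → ℝ} (hf : MemLipP p f) {v : X → X} (hv : SteepestAscent f v)
    {w B : ℝ} (hw : 0 ≤ w) (hφw : φ w ≠ ⊤)
    (hB : B < (∑ i, α i * locLip f (x i) ^ q) ^ (1 / q) * w - (φ w).toReal) :
    ∀ᶠ h in 𝓝[>] (0 : ℝ),
      ((∑ i, α i * f (x i) + h * B : ℝ) : EReal) ≤ IDirac x α φ p D h f := by
  filter_upwards [eventually_exists_shift hp hpq x hα hD hzeroD hf hv hw (sub_pos.2 hB),
    self_mem_nhdsWithin] with h hd h0
  have h0 : 0 < h := h0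
  obtain ⟨d, hdD, hdN, hdF⟩ := hd
  have hdiv : h * w / h = w := by field_simp
  refine le_trans ?_ (le_iSup₂ (f := fun (d : Fin n → X) (_ : d ∈ D) =>
    ((∑ i, α i * f (x i + d i) : ℝ) : EReal)
      - ((phih φ h ((∑ i, α i * ‖d i‖ ^ p) ^ (1 / p)) : ℝ≥0∞) : EReal)) d hdD)
  have hN0 : 0 ≤ (∑ i, α i * ‖d i‖ ^ p) ^ (1 / p) :=
    Real.rpow_nonneg (Finset.sum_nonneg fun i _ => mul_nonneg (hα i) (by positivity)) _
  refine le_trans ?_ (EReal.sub_le_sub le_rfl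
    (EReal.coe_ennreal_le_coe_ennreal_iff.2 (phih_mono hmono h0 hN0 hdN)))
  rw [coe_phih h0 (by rwa [hdiv]), hdiv, ← EReal.coe_sub, EReal.coe_le_coe_iff]
  linarith

theorem stmt8 (p : ℝ) (hp : 1 < p)
    (φ : ℝ → ℝ≥0∞) (hmono : MonotoneOn φ (Ici (0 : ℝ))) (hzero : φ 0 = 0)
    (hgrowth : 0 < liminf (fun v : ℝ => φ v / ENNReal.ofReal (v ^ p)) atTop)
    (n : ℕ) (x : Fin n → X) (α : Fin n → ℝ) (hα : ∀ i, 0 < α i) (hsum : ∑ i, α i = 1)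
    (μ : Measure X) (hμ : μ = ∑ i, ENNReal.ofReal (α i) • Measure.dirac (x i))
    (D : Set (Fin n → X)) (hD : Dense D) (hzeroD : (fun _ : Fin n => (0 : X)) ∈ D)
    (f : X → ℝ) (hf : MemLipP p f) (v : X → X) (hv : SteepestAscent f v) :
    Tendsto (fun h : ℝ =>
        ((h⁻¹ : ℝ) : EReal) * (Ifun μ φ p h f - IDirac x α φ p D h f))
      (𝓝[>] (0 : ℝ)) (𝓝 (0 : EReal)) := by
  have hα' : ∀ i, 0 ≤ α i := fun i => (hα i).le
  have hpq : p.HolderConjugate p.conjExponent := Real.HolderConjugate.conjExponent hp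
  set q := p.conjExponent
  have hΛ0 : 0 ≤ (∑ i, α i * locLip f (x i) ^ q) ^ (1 / q) :=
    Real.rpow_nonneg (Finset.sum_nonneg fun i _ =>
      mul_nonneg (hα' i) (Real.rpow_nonneg (locLip_nonneg hp hf _) _)) _
  obtain ⟨K, hKlow, hKup⟩ := exists_conjugate hp hzero hgrowth hΛ0
  have hle : ∀ δ > 0, ∀ᶠ h in 𝓝[>] (0 : ℝ), ∃ r : ℝ, 0 ≤ r ∧ r ≤ 2 * δ ∧
      ((h⁻¹ : ℝ) : EReal) * (Ifun μ φ p h f - IDirac x α φ p D h f) = (r : EReal) := by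
    intro δ hδ
    obtain ⟨w, hw, hφw, hwK⟩ := hKlow δ hδ
    obtain ⟨ε, hε, hup⟩ := hKup δ hδ
    filter_upwards [eventually_Ifun_le hp hpq x hα' hsum hf hε hup,
      eventually_le_IDirac hp hpq hmono x hα' hD hzeroD hf hv hw hφw hwK,
      self_mem_nhdsWithin] with h h1 h2 h0
    have h0 : 0 < h := h0
    have h3 := IDirac_le_Ifun (zero_lt_one.trans hp) hmono x hα' hsum D h0 f
    rw [← hμ] at h1 h3
    lift Ifun μ φ p h f to ℝ using ⟨ne_top_of_le_ne_top (EReal.coe_ne_top _) h1,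
      ne_bot_of_le_ne_bot (EReal.coe_ne_bot _) (h2.trans h3)⟩ with I
    lift IDirac x α φ p D h f to ℝ using ⟨ne_top_of_le_ne_top (EReal.coe_ne_top _) h3,
      ne_bot_of_le_ne_bot (EReal.coe_ne_bot _) h2⟩ with J
    rw [EReal.coe_le_coe_iff] at h1 h2 h3
    refine ⟨h⁻¹ * (I - J), mul_nonneg (by positivity) (sub_nonneg.2 h3), ?_, by
      rw [EReal.coe_mul, EReal.coe_sub]⟩
    rw [inv_mul_le_iff₀ h0]
    linarith
  refine tendsto_order.2 ⟨fun a ha => ?_, fun b hb => ?_⟩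
  · filter_upwards [hle 1 one_pos] with h hh
    obtain ⟨r, hr0, -, hr⟩ := hh
    rw [hr]
    exact ha.trans_le (by exact_mod_cast hr0)
  · obtain ⟨c, hc0, hcb⟩ := EReal.lt_iff_exists_real_btwn.1 hb
    have hc0 : 0 < c := by exact_mod_cast hc0
    filter_upwards [hle (c / 2) (by positivity)] with h hh
    obtain ⟨r, -, hrc, hr⟩ := hh
    rw [hr]
    refine lt_of_le_of_lt ?_ hcb
    rw [EReal.coe_le_coe_iff]
    linarith
end
end
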